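/- arXiv:2205.04009 — 10 statements merged into one kernel-verified Lean document; each statement's English description precedes it below -/
import Mathlib

section
/- Let x_1,…,x_N ∈ ℝ^{D0} and y_1,…,y_N ∈ ℝ^{d2} be a finite dataset, let A = (1/N)Σ_k x_k x_kᵀ, and suppose A = P Φ Pᵀ where P ∈ ℝ^{D0×d0} has orthonormal columns and Φ = diag(φ_1,…,φ_{d0}) has strictly positive diagonal entries, and suppose each x_k lies in the column space of P (i.e. P Pᵀ x_k = x_k). Set x̃_k = Φ^{-1/2} Pᵀ x_k and Z = (1/N)Σ_k y_k x̃_kᵀ. Then for every U ∈ ℝ^{d2×d1}, every W ∈ ℝ^{D0×d1}, every positive semidefinite Σ ∈ ℝ^{d1×d1}, and every c > 0, with V := Φ^{1/2} Pᵀ W, the identity (1/N)Σ_k ‖U Wᵀ x_k − y_k‖² + Tr(U Σ Uᵀ) + c·Tr(Wᵀ A W) = ‖U Vᵀ − Z‖_F² + Tr(U Σ Uᵀ) + c‖V‖_F² − ‖Z‖_F² + (1/N)Σ_k ‖y_k‖² holds. In particular, minimizing the left-hand side over (U, W) is equivalent to minimizing ‖U Vᵀ − Z‖_F² + Tr(U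 Σ Uᵀ) + c‖V‖_F² over (U, V). -/
open Matrix BigOperators

noncomputable def frobSq {m n : ℕ} (M : Matrix (Fin m) (Fin n) ℝ) : ℝ :=
  ∑ i, ∑ j, (M i j) ^ 2

noncomputable def vnormSq {n : ℕ} (v : Fin n → ℝ) : ℝ := ∑ i, (v i) ^ 2

theorem frobSq_eq_trace {m n : ℕ} (M : Matrix (Fin m) (Fin n) ℝ) :
    frobSq M = Matrix.trace (M * Mᵀ) := by
  simp [frobSq, Matrix.trace, Matrix.mul_apply, pow_two]

theorem vnormSq_sub_eq {m n : ℕ} (B : Matrix (Fin m) (Fin n) ℝ) (x : Fin n → ℝ)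
    (y : Fin m → ℝ) :
    vnormSq (B.mulVec x - y) = Matrix.trace (B * Matrix.vecMulVec x x * Bᵀ)
      - 2 * Matrix.trace (B * (Matrix.vecMulVec y x)ᵀ) + vnormSq y := by
  have h1 : B * Matrix.vecMulVec x x * Bᵀ
      = Matrix.vecMulVec (B.mulVec x) (B.mulVec x) := by
    rw [Matrix.mul_vecMulVec, Matrix.vecMulVec_mul, Matrix.vecMul_transpose]
  have h2 : B * (Matrix.vecMulVec y x)ᵀ = Matrix.vecMulVec (B.mulVec x) y := by
    rw [Matrix.transpose_vecMulVec, Matrix.mul_vecMulVec]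
  rw [h1, h2]
  simp only [vnormSq, Matrix.trace, Matrix.diag, Matrix.vecMulVec_apply, Pi.sub_apply,
    Finset.mul_sum, ← Finset.sum_sub_distrib, ← Finset.sum_add_distrib]
  exact Finset.sum_congr rfl fun i _ => by ring

/-- reduction of the linear VAE objective to regularized matrix
factorization via the whitening change of variables. -/
theorem vae_objective_eq_regularized_matrix_factorization
    (N D0 d0 d1 d2 : ℕ) (hN : 0 < N)
    (x : Fin N → Fin D0 → ℝ) (y : Fin N → Fin d2 → ℝ)
    (A : Matrix (Fin D0) (Fin D0) ℝ)
    (hA : A = (N : ℝ)⁻¹ • ∑ k, Matrix.vecMulVec (x k) (x k))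
    (P : Matrix (Fin D0) (Fin d0) ℝ) (φ : Fin d0 → ℝ)
    (hφ : ∀ i, 0 < φ i)
    (hPorth : Pᵀ * P = 1)
    (hAeig : A = P * Matrix.diagonal φ * Pᵀ)
    (hspan : ∀ k, (P * Pᵀ).mulVec (x k) = x k)
    (xt : Fin N → Fin d0 → ℝ)
    (hxt : ∀ k, xt k = (Matrix.diagonal fun i => (Real.sqrt (φ i))⁻¹).mulVec (Pᵀ.mulVec (x k)))
    (Z : Matrix (Fin d2) (Fin d0) ℝ)
    (hZ : Z = (N : ℝ)⁻¹ • ∑ k, Matrix.vecMulVec (y k) (xt k))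
    (U : Matrix (Fin d2) (Fin d1) ℝ) (W : Matrix (Fin D0) (Fin d1) ℝ)
    (S : Matrix (Fin d1) (Fin d1) ℝ) (hS : S.PosSemidef)
    (c : ℝ) (hc : 0 < c)
    (V : Matrix (Fin d0) (Fin d1) ℝ)
    (hV : V = (Matrix.diagonal fun i => Real.sqrt (φ i)) * Pᵀ * W) :
    (N : ℝ)⁻¹ * (∑ k, vnormSq ((U * Wᵀ).mulVec (x k) - y k))
      + Matrix.trace (U * S * Uᵀ) + c * Matrix.trace (Wᵀ * A * W)
    = frobSq (U * Vᵀ - Z) + Matrix.trace (U * S * Uᵀ) + c * frobSq V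
      - frobSq Z + (N : ℝ)⁻¹ * (∑ k, vnormSq (y k)) := by
  set R := Matrix.diagonal fun i => (Real.sqrt (φ i))⁻¹ with hR
  set Q := Matrix.diagonal fun i => Real.sqrt (φ i) with hQ
  have hs : ∀ i, Real.sqrt (φ i) ≠ 0 := fun i => (Real.sqrt_pos.2 (hφ i)).ne'
  have hQR : Q * R = 1 := by
    rw [hQ, hR, Matrix.diagonal_mul_diagonal, ← Matrix.diagonal_one]
    congr 1; funext i; exact mul_inv_cancel₀ (hs i)
  have hRQ : R * Q = 1 := by
    rw [hQ, hR, Matrix.diagonal_mul_diagonal, ← Matrix.diagonal_one]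
    congr 1; funext i; exact inv_mul_cancel₀ (hs i)
  have hQQ : Matrix.diagonal φ = Q * Q := by
    rw [hQ, Matrix.diagonal_mul_diagonal]
    congr 1; funext i; exact (Real.mul_self_sqrt (hφ i).le).symm
  have hQt : Qᵀ = Q := Matrix.diagonal_transpose _
  have hRt : Rᵀ = R := Matrix.diagonal_transpose _
  have hG : (N : ℝ)⁻¹ • ∑ k, Matrix.vecMulVec (xt k) (xt k) = 1 := by
    have e : ∀ k, Matrix.vecMulVec (xt k) (xt k)
        = (R * Pᵀ) * Matrix.vecMulVec (x k) (x k) * (R * Pᵀ)ᵀ := by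
      intro k
      rw [Matrix.mul_vecMulVec, Matrix.vecMulVec_mul, Matrix.vecMul_transpose, hxt k,
        Matrix.mulVec_mulVec]
    simp only [e]
    rw [← Matrix.sum_mul, ← Matrix.mul_sum, ← Matrix.smul_mul, ← Matrix.mul_smul, ← hA, hAeig,
      hQQ, Matrix.transpose_mul, Matrix.transpose_transpose, hRt]
    calc R * Pᵀ * (P * (Q * Q) * Pᵀ) * (P * R)
        = R * (Pᵀ * P) * Q * Q * (Pᵀ * P) * R := by simp only [Matrix.mul_assoc]
      _ = (R * Q) * (Q * R) := by rw [hPorth]; simp only [Matrix.mul_assoc, Matrix.mul_one, Matrix.one_mul]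
      _ = 1 := by rw [hRQ, hQR, Matrix.mul_one]
  have hx : ∀ k, (U * Wᵀ).mulVec (x k) = (U * Vᵀ).mulVec (xt k) := by
    intro k
    have : U * Vᵀ * R * Pᵀ = U * Wᵀ * (P * Pᵀ) := by
      rw [hV, Matrix.transpose_mul, Matrix.transpose_mul, Matrix.transpose_transpose, hQt]
      calc U * (Wᵀ * (P * Q)) * R * Pᵀ = U * Wᵀ * P * (Q * R) * Pᵀ := by
            simp only [Matrix.mul_assoc]
        _ = _ := by rw [hQR, Matrix.mul_one]; simp only [Matrix.mul_assoc]
    rw [hxt k, Matrix.mulVec_mulVec, Matrix.mulVec_mulVec, this,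
      ← Matrix.mulVec_mulVec (x k) (U * Wᵀ), hspan]
  have hW : Matrix.trace (Wᵀ * A * W) = frobSq V := by
    rw [frobSq_eq_trace, Matrix.trace_mul_comm V, hAeig, hQQ, hV, Matrix.transpose_mul,
      Matrix.transpose_mul, Matrix.transpose_transpose, hQt]
    simp only [Matrix.mul_assoc]
  have hmain : (N : ℝ)⁻¹ * (∑ k, vnormSq ((U * Vᵀ).mulVec (xt k) - y k))
      = Matrix.trace ((U * Vᵀ) * (U * Vᵀ)ᵀ) - 2 * Matrix.trace ((U * Vᵀ) * Zᵀ)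
        + (N : ℝ)⁻¹ * (∑ k, vnormSq (y k)) := by
    generalize U * Vᵀ = B
    have e1 : Matrix.trace (B * Bᵀ)
        = (N : ℝ)⁻¹ * ∑ k, Matrix.trace (B * Matrix.vecMulVec (xt k) (xt k) * Bᵀ) := by
      rw [← Matrix.trace_sum, ← Matrix.sum_mul, ← Matrix.mul_sum, ← smul_eq_mul,
        ← Matrix.trace_smul, ← Matrix.smul_mul, ← Matrix.mul_smul, hG, Matrix.mul_one]
    have e2 : Matrix.trace (B * Zᵀ)
        = (N : ℝ)⁻¹ * ∑ k, Matrix.trace (B * (Matrix.vecMulVec (y k) (xt k))ᵀ) := by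
      rw [← Matrix.trace_sum, ← Matrix.mul_sum, ← smul_eq_mul,
        ← Matrix.trace_smul, ← Matrix.mul_smul, ← Matrix.transpose_sum,
        ← Matrix.transpose_smul, ← hZ]
    rw [e1, e2]
    simp only [vnormSq_sub_eq, Finset.sum_add_distrib, Finset.sum_sub_distrib, ← Finset.mul_sum]
    ring
  have hF : frobSq (U * Vᵀ - Z) = Matrix.trace ((U * Vᵀ) * (U * Vᵀ)ᵀ)
      - 2 * Matrix.trace ((U * Vᵀ) * Zᵀ) + frobSq Z := by
    generalize U * Vᵀ = B
    have : Matrix.trace (Z * Bᵀ) = Matrix.trace (B * Zᵀ) := by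
      rw [← Matrix.trace_transpose, Matrix.transpose_mul, Matrix.transpose_transpose]
    rw [frobSq_eq_trace, frobSq_eq_trace, Matrix.transpose_sub, Matrix.sub_mul, Matrix.mul_sub,
      Matrix.mul_sub, Matrix.trace_sub, Matrix.trace_sub, Matrix.trace_sub, this]
    ring
  simp only [hx]
  rw [hmain, hF, hW]
  ring
end

section
/- Fix reals β > 0, η_enc > 0, η_dec > 0 and ζ ≥ 0, and define l : (0,∞) → ℝ by l(σ) = ζ² − (ζ − (√β η_dec/η_enc)σ)² · 1{ζ > (√β η_dec/η_enc)σ} + β η_dec² (σ²/η_enc² − 1 − log(σ²/η_enc²)), where 1{·} is the indicator of the stated inequality. Then the global minimizer of l over σ ∈ (0,∞) is σ* = (√β η_dec/ζ) η_enc if β η_dec² < ζ², and σ* = η_enc if β η_dec² ≥ ζ²; that is, l(σ*) ≤ l(σ) for all σ > 0 with the stated σ*. -/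
/-- the optimal per-coordinate encoder standard deviation. -/
theorem optimal_encoder_std
    (β ηenc ηdec ζ : ℝ) (hβ : 0 < β) (henc : 0 < ηenc) (hdec : 0 < ηdec)
    (hζ : 0 ≤ ζ)
    (l : ℝ → ℝ)
    (hl : ∀ σ : ℝ, l σ = ζ ^ 2 -
        (if Real.sqrt β * ηdec / ηenc * σ < ζ
          then (ζ - Real.sqrt β * ηdec / ηenc * σ) ^ 2 else 0)
        + β * ηdec ^ 2 * (σ ^ 2 / ηenc ^ 2 - 1 - Real.log (σ ^ 2 / ηenc ^ 2)))
    (σstar : ℝ)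
    (hσstar : σstar = if β * ηdec ^ 2 < ζ ^ 2
        then Real.sqrt β * ηdec / ζ * ηenc else ηenc) :
    ∀ σ : ℝ, 0 < σ → l σstar ≤ l σ := by
  intro σ hσ
  obtain ⟨a, ha⟩ : ∃ a, a = Real.sqrt β * ηdec := ⟨_, rfl⟩
  have ha0 : 0 < a := by rw [ha]; positivity
  have ha2 : β * ηdec ^ 2 = a ^ 2 := by rw [ha, mul_pow, Real.sq_sqrt hβ.le]
  have key : ∀ t : ℝ, l (t * ηenc) = ζ ^ 2 - (if a * t < ζ then (ζ - a * t) ^ 2 else 0)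
      + a ^ 2 * (t ^ 2 - 1 - 2 * Real.log t) := by
    intro t
    have h1 : a / ηenc * (t * ηenc) = a * t := by field_simp
    have h2 : (t * ηenc) ^ 2 / ηenc ^ 2 = t ^ 2 := by field_simp
    rw [hl, ← ha, ha2, h1, h2, Real.log_pow]
    norm_num
  obtain ⟨t, ht⟩ : ∃ t, t = σ / ηenc := ⟨_, rfl⟩
  have ht0 : 0 < t := by rw [ht]; positivity
  have hs : σ = t * ηenc := by rw [ht]; field_simp
  rw [hs, key]
  rw [ha2, ← ha] at hσstar
  by_cases hc : a ^ 2 < ζ ^ 2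
  · rw [if_pos hc] at hσstar
    have haz : a < ζ := lt_of_pow_lt_pow_left₀ 2 hζ hc
    have hz : 0 < ζ := ha0.trans haz
    have h3 : a * (a / ζ) < ζ := by
      rw [← mul_div_assoc, div_lt_iff₀ hz]; nlinarith
    rw [hσstar, key, if_pos h3, Real.log_div ha0.ne' hz.ne']
    have h4 := Real.log_le_sub_one_of_pos (show 0 < ζ * t / a by positivity)
    rw [Real.log_div (by positivity) ha0.ne', Real.log_mul hz.ne' ht0.ne'] at h4
    have h5 := mul_le_mul_of_nonneg_left h4 (sq_nonneg a)
    have h6 : a ^ 2 * (ζ * t / a - 1) = a * ζ * t - a ^ 2 := by field_simp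
    have h7 : ζ * (a / ζ) = a := by field_simp
    rw [h6] at h5
    have h8 : ζ ^ 2 - (ζ - a * (a / ζ)) ^ 2 = 2 * a ^ 2 - a ^ 2 * (a / ζ) ^ 2 := by
      linear_combination 2 * a * h7
    rw [h8]
    split_ifs with h
    · nlinarith
    · nlinarith [sq_nonneg (ζ - a * t)]
  · rw [if_neg hc] at hσstar
    have haz : ζ ≤ a := by
      by_contra h
      push Not at h
      exact hc (by gcongr)
    have h1 := key 1
    rw [one_mul, if_neg (by linarith)] at h1
    rw [hσstar, h1, Real.log_one]
    have h5 := mul_le_mul_of_nonneg_left (Real.log_le_sub_one_of_pos ht0) (sq_nonneg a)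
    split_ifs with h
    · have : (ζ - a * t) ^ 2 ≤ (a - a * t) ^ 2 := by
        apply pow_le_pow_left₀ <;> linarith
      nlinarith
    · nlinarith [sq_nonneg (a * (t - 1))]
end

section
/- Let x_1,…,x_N ∈ ℝ^{D0} and y_1,…,y_N ∈ ℝ^{d2} be a finite dataset with means x̄ = (1/N)Σ_k x_k and ȳ = (1/N)Σ_k y_k. Fix U ∈ ℝ^{d2×d1}, W ∈ ℝ^{D0×d1}, and c > 0, and define h(b_e, b_d) = (1/N)Σ_k [ ‖U(Wᵀx_k + b_e) + b_d − y_k‖² + c‖Wᵀx_k + b_e‖² ] for b_e ∈ ℝ^{d1}, b_d ∈ ℝ^{d2}. Then (b_e*, b_d*) = (−Wᵀ x̄, ȳ) is a global minimizer of h: h(−Wᵀ x̄, ȳ) ≤ h(b_e, b_d) for all b_e, b_d. Consequently, including learnable encoder and decoder biases in the linear VAE is equivalent to centering the input and target data to zero mean. -/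
open Matrix BigOperators

lemma vnormSq_shift {N n : ℕ} (a : Fin N → Fin n → ℝ) (t : Fin n → ℝ)
    (ha : ∑ k, a k = 0) : ∑ k, vnormSq (a k) ≤ ∑ k, vnormSq (a k + t) := by
  unfold vnormSq
  rw [Finset.sum_comm, Finset.sum_comm (s := Finset.univ (α := Fin N))]
  refine Finset.sum_le_sum fun i _ => ?_
  have h0 : ∑ k, a k i = 0 := by
    have := congrFun ha i
    simpa using this
  have h1 : ∑ k, (a k + t) i ^ 2 = ∑ k, (a k i) ^ 2 + 2 * t i * ∑ k, a k i + ∑ _k : Fin N, t i ^ 2 := by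
    rw [Finset.mul_sum, ← Finset.sum_add_distrib, ← Finset.sum_add_distrib]
    refine Finset.sum_congr rfl fun k _ => ?_
    simp only [Pi.add_apply]
    ring
  rw [h1, h0]
  have : 0 ≤ ∑ _k : Fin N, t i ^ 2 := Finset.sum_nonneg fun _ _ => sq_nonneg _
  linarith

lemma sum_centered {N n : ℕ} (hN : 0 < N) (x : Fin N → Fin n → ℝ) :
    ∑ k, (x k - (N : ℝ)⁻¹ • ∑ j, x j) = 0 := by
  have hN' : (N : ℝ) ≠ 0 := by positivity
  rw [Finset.sum_sub_distrib, Finset.sum_const, Finset.card_univ, Fintype.card_fin,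
    ← Nat.cast_smul_eq_nsmul ℝ, smul_smul, mul_inv_cancel₀ hN', one_smul, sub_self]

/-- the optimal encoder/decoder biases of the linear VAE are
`b_e* = −Wᵀ x̄` and `b_d* = ȳ`. -/
theorem optimal_biases
    (N D0 d1 d2 : ℕ) (hN : 0 < N)
    (x : Fin N → Fin D0 → ℝ) (y : Fin N → Fin d2 → ℝ)
    (xbar : Fin D0 → ℝ) (hxbar : xbar = (N : ℝ)⁻¹ • ∑ k, x k)
    (ybar : Fin d2 → ℝ) (hybar : ybar = (N : ℝ)⁻¹ • ∑ k, y k)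
    (U : Matrix (Fin d2) (Fin d1) ℝ) (W : Matrix (Fin D0) (Fin d1) ℝ)
    (c : ℝ) (hc : 0 < c)
    (h : (Fin d1 → ℝ) → (Fin d2 → ℝ) → ℝ)
    (hh : ∀ be bd, h be bd = (N : ℝ)⁻¹ * ∑ k,
        (vnormSq (U.mulVec (Wᵀ.mulVec (x k) + be) + bd - y k)
          + c * vnormSq (Wᵀ.mulVec (x k) + be))) :
    ∀ be bd, h (-(Wᵀ.mulVec xbar)) ybar ≤ h be bd := by
  intro be bd
  have hx : ∑ k, (x k - xbar) = 0 := by rw [hxbar]; exact sum_centered hN x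
  have hy : ∑ k, (y k - ybar) = 0 := by rw [hybar]; exact sum_centered hN y
  have hWx : ∑ k, Wᵀ.mulVec (x k - xbar) = 0 := by
    rw [← Matrix.mulVec_sum, hx, Matrix.mulVec_zero]
  have hr : ∑ k, (U.mulVec (Wᵀ.mulVec (x k - xbar)) - (y k - ybar)) = 0 := by
    rw [Finset.sum_sub_distrib, hy, ← Matrix.mulVec_sum, hWx, Matrix.mulVec_zero, sub_zero]
  have h1 := vnormSq_shift _ (U.mulVec (Wᵀ.mulVec xbar + be) + bd - ybar) hr
  have h2 := vnormSq_shift _ (Wᵀ.mulVec xbar + be) hWx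
  have e1 : ∀ k, U.mulVec (Wᵀ.mulVec (x k) + -(Wᵀ.mulVec xbar)) + ybar - y k
      = U.mulVec (Wᵀ.mulVec (x k - xbar)) - (y k - ybar) := fun k => by
    rw [Matrix.mulVec_sub, ← sub_eq_add_neg]; abel
  have e2 : ∀ k, Wᵀ.mulVec (x k) + -(Wᵀ.mulVec xbar) = Wᵀ.mulVec (x k - xbar) := fun k => by
    rw [Matrix.mulVec_sub, ← sub_eq_add_neg]
  have e3 : ∀ k, U.mulVec (Wᵀ.mulVec (x k) + be) + bd - y k
      = U.mulVec (Wᵀ.mulVec (x k - xbar)) - (y k - ybar)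
        + (U.mulVec (Wᵀ.mulVec xbar + be) + bd - ybar) := fun k => by
    simp only [Matrix.mulVec_sub, Matrix.mulVec_add]; abel
  have e4 : ∀ k, Wᵀ.mulVec (x k) + be
      = Wᵀ.mulVec (x k - xbar) + (Wᵀ.mulVec xbar + be) := fun k => by
    rw [Matrix.mulVec_sub]; abel
  rw [hh, hh]
  refine mul_le_mul_of_nonneg_left ?_ (by positivity)
  rw [Finset.sum_add_distrib, Finset.sum_add_distrib, ← Finset.mul_sum, ← Finset.mul_sum]
  refine add_le_add ?_ (mul_le_mul_of_nonneg_left ?_ hc.le)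
  · rw [Finset.sum_congr rfl fun k _ => congrArg vnormSq (e1 k),
      Finset.sum_congr rfl fun k _ => congrArg vnormSq (e3 k)]
    exact h1
  · rw [Finset.sum_congr rfl fun k _ => congrArg vnormSq (e2 k),
      Finset.sum_congr rfl fun k _ => congrArg vnormSq (e4 k)]
    exact h2
end

section
/- Let x_1,…,x_N ∈ ℝ^{d0} with (1/N)Σ_k x_k = 0, y_1,…,y_N ∈ ℝ^{d2}, and A = (1/N)Σ_k x_k x_kᵀ. For C ∈ ℝ^{d1×d0} and f ∈ ℝ^{d1}, define σ_i(x) = |C_{i·} x + f_i| (where C_{i·} is the i-th row of C), and assume C_{i·} x_k + f_i ≠ 0 for every i and k. Define L^{DDV}(U, W, C, f) = (1/(2η_dec²)) (1/N) Σ_k [ ‖U Wᵀ x_k − y_k‖² + Tr(U diag(σ_1(x_k)²,…,σ_{d1}(x_k)²) Uᵀ) + β(η_dec²/η_enc²)‖Wᵀ x_k‖² ] + (β/2) Σ_{i=1}^{d1} (1/N) Σ_k ( σ_i(x_k)²/η_enc² − 1 − log(σ_i(x_k)²/η_enc²) ). Then for every U ∈ ℝ^{d2×d1}, W ∈ ℝ^{d0×d1},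 C, f as above, setting f'_i = sqrt(f_i² + C_{i·} A C_{i·}ᵀ) gives L^{DDV}(U, W, C, f) ≥ L^{DDV}(U, W, 0, f'). That is, for a linear data-dependent encoder standard deviation, it is always at least as good to use a data-independent one with the same second moment. -/
open Matrix BigOperators

lemma aux_trace {m n : ℕ} (U : Matrix (Fin m) (Fin n) ℝ) (v : Fin n → ℝ) :
    Matrix.trace (U * Matrix.diagonal v * Uᵀ) = ∑ i, (∑ a, U a i ^ 2) * v i := by
  simp only [Matrix.trace, Matrix.diag]
  simp only [Matrix.mul_apply (M := U * Matrix.diagonal v), Matrix.mul_diagonal,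
    Matrix.transpose_apply, Finset.sum_mul]
  rw [Finset.sum_comm]
  refine Finset.sum_congr rfl fun i _ => Finset.sum_congr rfl fun a _ => ?_
  ring

lemma aux_quad {N d0 : ℕ} (x : Fin N → Fin d0 → ℝ) (c : Fin d0 → ℝ) :
    c ⬝ᵥ ((N : ℝ)⁻¹ • ∑ k, Matrix.vecMulVec (x k) (x k)).mulVec c
      = (N : ℝ)⁻¹ * ∑ k, (c ⬝ᵥ x k) ^ 2 := by
  rw [Matrix.smul_mulVec, dotProduct_smul, smul_eq_mul, Matrix.sum_mulVec, dotProduct_sum]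
  congr 1
  refine Finset.sum_congr rfl fun k _ => ?_
  rw [Matrix.vecMulVec_mulVec, dotProduct_comm (x k) c]
  simp [sq]

lemma aux_moment {N d0 : ℕ} (hN : 0 < N) (x : Fin N → Fin d0 → ℝ) (hx0 : ∑ k, x k = 0)
    (c : Fin d0 → ℝ) (f : ℝ) :
    ∑ k, (c ⬝ᵥ x k + f) ^ 2 = N * (f ^ 2 + (N : ℝ)⁻¹ * ∑ k, (c ⬝ᵥ x k) ^ 2) := by
  have hN' : (N : ℝ) ≠ 0 := by positivity
  have h0 : ∑ k, c ⬝ᵥ x k = 0 := by rw [← dotProduct_sum, hx0, dotProduct_zero]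
  have h1 : ∀ k, (c ⬝ᵥ x k + f) ^ 2 = (c ⬝ᵥ x k) ^ 2 + (2 * f) * (c ⬝ᵥ x k) + f ^ 2 :=
    fun k => by ring
  simp only [h1, Finset.sum_add_distrib, ← Finset.mul_sum, h0]
  simp
  field_simp
  ring

lemma aux_log {N : ℕ} (s : Fin N → ℝ) (hs : ∀ k, 0 < s k) (S : ℝ) (hS : 0 < S)
    (h : ∑ k, s k = N * S) : ∑ k, Real.log (s k) ≤ N * Real.log S := by
  have h1 : ∀ k, Real.log (s k) ≤ Real.log S + (s k / S - 1) := fun k => by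
    have := Real.log_le_sub_one_of_pos (div_pos (hs k) hS)
    rw [Real.log_div (hs k).ne' hS.ne'] at this
    linarith
  calc _ ≤ ∑ k, (Real.log S + (s k / S - 1)) := Finset.sum_le_sum fun k _ => h1 k
    _ = _ := by
      rw [Finset.sum_add_distrib, Finset.sum_sub_distrib, ← Finset.sum_div, h]
      simp
      field_simp
      ring

/-- a linear data-dependent encoder standard deviation is never
better than the data-independent one with the same second moment. -/
theorem data_dependent_variance_never_better
    (N d0 d1 d2 : ℕ) (hN : 0 < N)
    (β ηenc ηdec : ℝ) (hβ : 0 < β) (henc : 0 < ηenc) (hdec : 0 < ηdec)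
    (x : Fin N → Fin d0 → ℝ) (hx0 : ∑ k, x k = 0)
    (y : Fin N → Fin d2 → ℝ)
    (A : Matrix (Fin d0) (Fin d0) ℝ)
    (hA : A = (N : ℝ)⁻¹ • ∑ k, Matrix.vecMulVec (x k) (x k))
    (LD : Matrix (Fin d2) (Fin d1) ℝ → Matrix (Fin d0) (Fin d1) ℝ →
        Matrix (Fin d1) (Fin d0) ℝ → (Fin d1 → ℝ) → ℝ)
    (hLD : ∀ U W C f, LD U W C f =
        (1 / (2 * ηdec ^ 2)) * ((N : ℝ)⁻¹ * ∑ k,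
          (vnormSq ((U * Wᵀ).mulVec (x k) - y k)
            + Matrix.trace (U * Matrix.diagonal
                (fun i => (C i ⬝ᵥ x k + f i) ^ 2) * Uᵀ)
            + β * (ηdec ^ 2 / ηenc ^ 2) * vnormSq (Wᵀ.mulVec (x k))))
        + (β / 2) * ∑ i : Fin d1, (N : ℝ)⁻¹ * ∑ k,
            ((C i ⬝ᵥ x k + f i) ^ 2 / ηenc ^ 2 - 1
              - Real.log ((C i ⬝ᵥ x k + f i) ^ 2 / ηenc ^ 2))) :
    ∀ (U : Matrix (Fin d2) (Fin d1) ℝ) (W : Matrix (Fin d0) (Fin d1) ℝ)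
      (C : Matrix (Fin d1) (Fin d0) ℝ) (f : Fin d1 → ℝ),
      (∀ i k, C i ⬝ᵥ x k + f i ≠ 0) →
      ∀ f' : Fin d1 → ℝ,
        (∀ i, f' i = Real.sqrt (f i ^ 2 + C i ⬝ᵥ A.mulVec (C i))) →
        LD U W 0 f' ≤ LD U W C f := by
  intro U W C f hne f' hf'
  have hN' : (0 : ℝ) < N := by exact_mod_cast hN
  have hm : ∀ i, ∑ k, (C i ⬝ᵥ x k + f i) ^ 2 = N * f' i ^ 2 := fun i => by
    rw [hf', Real.sq_sqrt, hA, aux_quad, aux_moment hN x hx0]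
    rw [hA, aux_quad]
    positivity
  have hpos : ∀ i k, 0 < (C i ⬝ᵥ x k + f i) ^ 2 := fun i k => by
    have := hne i k
    positivity
  have hS : ∀ i, 0 < f' i ^ 2 := fun i => by
    have h1 : 0 < ∑ k, (C i ⬝ᵥ x k + f i) ^ 2 :=
      Finset.sum_pos (fun k _ => hpos i k) ⟨⟨0, hN⟩, Finset.mem_univ _⟩
    rw [hm] at h1
    exact pos_of_mul_pos_right h1 hN'.le
  have hz : ∀ i k, (0 : Matrix (Fin d1) (Fin d0) ℝ) i ⬝ᵥ x k + f' i = f' i := fun i k => by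
    have : (0 : Matrix (Fin d1) (Fin d0) ℝ) i = 0 := rfl
    rw [this, zero_dotProduct, zero_add]
  rw [hLD, hLD]
  simp only [hz, aux_trace]
  apply add_le_add
  · apply le_of_eq
    congr 2
    simp only [Finset.sum_add_distrib]
    congr 2
    rw [Finset.sum_comm]
    conv_rhs => rw [Finset.sum_comm]
    refine Finset.sum_congr rfl fun i _ => ?_
    rw [← Finset.mul_sum, ← Finset.mul_sum, hm]
    simp
  · refine mul_le_mul_of_nonneg_left (Finset.sum_le_sum fun i _ => ?_) (by positivity)
    refine mul_le_mul_of_nonneg_left ?_ (by positivity)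
    have hl := aux_log (fun k => (C i ⬝ᵥ x k + f i) ^ 2 / ηenc ^ 2)
      (fun k => div_pos (hpos i k) (by positivity)) (f' i ^ 2 / ηenc ^ 2)
      (div_pos (hS i) (by positivity)) (by rw [← Finset.sum_div, hm]; ring)
    simp only [Finset.sum_sub_distrib, ← Finset.sum_div, hm] at hl ⊢
    simp only [Finset.sum_const, Finset.card_univ, Fintype.card_fin, nsmul_eq_mul]
    linarith
end

section
/- Set s_p = ζ_p²/β for 1 ≤ p ≤ d̂_1. Let p be an integer with 1 ≤ p ≤ d̂_1 such that p ≤ d2/β, and let t > s_p. Then t² G'(t) > s_p² G'(s_p). -/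
open BigOperators

theorem F_hasDerivAt (β a : ℝ) (hβ : 0 < β) (ha : 0 < a) (F : ℝ → ℝ)
    (hF : ∀ s, F s = if s < a / β then a / s + β * (Real.log (β * s / a) - 1) else 0)
    (s : ℝ) (hs : 0 < s) : HasDerivAt F (min (β * s - a) 0 / s ^ 2) s := by
  have hf : HasDerivAt (fun s : ℝ => a / s + β * (Real.log (β * s / a) - 1))
      ((β * s - a) / s ^ 2) s := by
    have h1 : HasDerivAt (fun s : ℝ => a / s) (a * (-(s ^ 2)⁻¹)) s := by
      simpa [div_eq_mul_inv] using (hasDerivAt_inv hs.ne').const_mul a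
    have h0 : HasDerivAt (fun s : ℝ => β * s / a) (β * 1 / a) s :=
      ((hasDerivAt_id s).const_mul β).div_const a
    have h2 := ((h0.log (by positivity)).sub_const 1).const_mul β
    refine (h1.add h2).congr_deriv ?_
    field_simp
    ring
  rcases lt_trichotomy s (a / β) with h | h | h
  · have h' : β * s - a < 0 := by
      rw [lt_div_iff₀ hβ] at h; linarith
    rw [min_eq_left h'.le]
    refine hf.congr_of_eventuallyEq ?_
    filter_upwards [Iio_mem_nhds h] with x hx
    rw [hF, if_pos (Set.mem_Iio.1 hx)]
  · have h' : β * s - a = 0 := by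
      rw [h]; field_simp; ring
    rw [h'] at hf
    rw [h', min_self]
    have hval : a / s + β * (Real.log (β * s / a) - 1) = 0 := by
      have e1 : β * s / a = 1 := by rw [h]; field_simp
      have e2 : a / s = β := by rw [h]; field_simp
      rw [e1, e2]; simp
    have hl : HasDerivWithinAt F (0 / s ^ 2) (Set.Iic s) s := by
      refine hf.hasDerivWithinAt.congr (fun x hx => ?_) ?_
      · rcases lt_or_eq_of_le (Set.mem_Iic.1 hx) with hx | hx
        · rw [hF, if_pos (h ▸ hx)]
        · rw [hF, if_neg (by rw [hx, h]; exact lt_irrefl _), hx, hval]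
      · rw [hF, if_neg (by rw [← h]; exact lt_irrefl _), hval]
    have hr : HasDerivWithinAt F (0 / s ^ 2) (Set.Ici s) s := by
      rw [zero_div]
      refine (hasDerivWithinAt_const s (Set.Ici s) (0 : ℝ)).congr (fun x hx => ?_) ?_
      · rw [hF, if_neg (by rw [← h]; exact not_lt.2 hx)]
      · rw [hF, if_neg (by rw [← h]; exact lt_irrefl _)]
    have := hl.union hr
    rwa [Set.Iic_union_Ici, hasDerivWithinAt_univ] at this
  · have h' : 0 < β * s - a := by
      rw [div_lt_iff₀ hβ] at h; linarith
    rw [min_eq_right h'.le, zero_div]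
    refine (hasDerivAt_const s (0 : ℝ)).congr_of_eventuallyEq ?_
    filter_upwards [Ioi_mem_nhds h] with x hx
    rw [hF, if_neg (not_lt.2 (le_of_lt hx))]

/-- for `1 ≤ p ≤ d̂₁` with `p ≤ d2/β` and `t > s_p = ζ (p-1)² / β`, one has `t² G´(t) > s_p² G´(s_p)` (0-based indexing of `ζ`). -/
theorem G_deriv_vshape
    (β : ℝ) (hβ : 0 < β) (d2 : ℕ) (hd2 : 1 ≤ d2)
    (d1h dsh : ℕ) (hd1h : 1 ≤ d1h) (hd1s : d1h ≤ dsh)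
    (ζ : ℕ → ℝ) (hζpos : ∀ i < dsh, 0 < ζ i)
    (hζmono : ∀ i j, i ≤ j → j < dsh → ζ j ≤ ζ i)
    (Ffun : ℕ → ℝ → ℝ)
    (hFfun : ∀ i (s : ℝ), Ffun i s = if s < ζ i ^ 2 / β
        then ζ i ^ 2 / s + β * (Real.log (β * s / ζ i ^ 2) - 1) else 0)
    (G : ℝ → ℝ)
    (hG : ∀ s : ℝ, G s = (1 / (2 * s)) * ∑ i ∈ Finset.range dsh, ζ i ^ 2
        - (1 / 2) * ∑ i ∈ Finset.range d1h, Ffun i s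
        + ((d2 : ℝ) / 2) * Real.log s)
    :
    ∀ p : ℕ, 1 ≤ p → p ≤ d1h → (p : ℝ) ≤ (d2 : ℝ) / β →
      ∀ t : ℝ, ζ (p - 1) ^ 2 / β < t →
        (ζ (p - 1) ^ 2 / β) ^ 2 * deriv G (ζ (p - 1) ^ 2 / β)
          < t ^ 2 * deriv G t := by
  intro p hp1 hpd hpβ t ht
  have hpos : ∀ i, i < dsh → 0 < ζ i ^ 2 := fun i hi => pow_pos (hζpos i hi) 2
  have hder : ∀ s : ℝ, 0 < s → s ^ 2 * deriv G s =
      -(∑ i ∈ Finset.range dsh, ζ i ^ 2) / 2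
        - (1 / 2) * ∑ i ∈ Finset.range d1h, min (β * s - ζ i ^ 2) 0 + d2 / 2 * s := by
    intro s hs
    have hsum : HasDerivAt (fun s => ∑ i ∈ Finset.range d1h, Ffun i s)
        (∑ i ∈ Finset.range d1h, min (β * s - ζ i ^ 2) 0 / s ^ 2) s :=
      HasDerivAt.fun_sum fun i hi => F_hasDerivAt β (ζ i ^ 2) hβ
        (hpos i (lt_of_lt_of_le (Finset.mem_range.1 hi) hd1s)) (Ffun i) (hFfun i) s hs
    have h1 : HasDerivAt (fun s : ℝ => 1 / (2 * s)) (1 / 2 * (-(s ^ 2)⁻¹)) s := by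
      refine ((hasDerivAt_inv hs.ne').const_mul (1 / 2 : ℝ)).congr_of_eventuallyEq ?_
      filter_upwards with x
      simp [mul_comm]
    have hGd := ((h1.mul_const (∑ i ∈ Finset.range dsh, ζ i ^ 2)).sub
      (hsum.const_mul (1 / 2))).add ((Real.hasDerivAt_log hs.ne').const_mul ((d2 : ℝ) / 2))
    have hGe : G = _ := funext hG
    have hGd' := hGd.deriv
    rw [← Finset.sum_div] at hGd'
    rw [hGe]
    refine (congrArg (fun x => s ^ 2 * x) hGd').trans ?_
    field_simp
  set s := ζ (p - 1) ^ 2 / β with hsdef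
  have hs : 0 < s := div_pos (hpos _ (by omega)) hβ
  have hβs : β * s = ζ (p - 1) ^ 2 := by rw [hsdef]; field_simp
  rw [hder s hs, hder t (hs.trans ht)]
  have hdiff : ∑ i ∈ Finset.range d1h, (min (β * t - ζ i ^ 2) 0 - min (β * s - ζ i ^ 2) 0)
      ≤ ((p - 1 : ℕ) : ℝ) * (β * (t - s)) := by
    have hsub : Finset.range (p - 1) ⊆ Finset.range d1h :=
      Finset.range_subset_range.2 (by omega)
    rw [← Finset.sum_subset hsub]
    · have := Finset.sum_le_card_nsmul (Finset.range (p - 1))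
        (fun i => min (β * t - ζ i ^ 2) 0 - min (β * s - ζ i ^ 2) 0) (β * (t - s)) ?_
      · simpa using this
      · intro i _
        have hb : 0 < β * (t - s) := mul_pos hβ (by linarith)
        have := min_le_left (β * t - ζ i ^ 2) 0
        have := min_le_right (β * t - ζ i ^ 2) 0
        rcases min_choice (β * s - ζ i ^ 2) 0 with h | h <;> simp only [h] <;> linarith
    · intro i hi hi'
      simp only [Finset.mem_range, not_lt] at hi hi'
      have hle : ζ i ^ 2 ≤ ζ (p - 1) ^ 2 :=
        pow_le_pow_left₀ (hζpos i (by omega)).le (hζmono _ _ hi' (by omega)) 2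
      have : β * s < β * t := mul_lt_mul_of_pos_left ht hβ
      rw [min_eq_right (by linarith), min_eq_right (by linarith), sub_zero]
  rw [Finset.sum_sub_distrib] at hdiff
  rw [le_div_iff₀ hβ] at hpβ
  have hc : ((p - 1 : ℕ) : ℝ) = p - 1 := by push_cast [Nat.cast_sub hp1]; ring
  rw [hc] at hdiff
  have : ((p : ℝ) - 1) * (β * (t - s)) < d2 * (t - s) := by
    rw [← mul_assoc]
    exact mul_lt_mul_of_pos_right (by linarith) (by linarith)
  linarith
end

section
/- Assume d̂_1 < d̂* or d2/β − d̂_1 < 0. Then G has a unique global minimizer s* ∈ (0, ∞), and s* is the unique stationary point of G (the unique s > 0 with G'(s) = 0). -/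
open BigOperators

/-- Derivative of the piecewise summand. -/
lemma hasDerivAt_F (β z : ℝ) (hβ : 0 < β) (hz : 0 < z) (F : ℝ → ℝ)
    (hF : ∀ s, F s = if s < z / β then z / s + β * (Real.log (β * s / z) - 1) else 0)
    (s : ℝ) (hs : 0 < s) : HasDerivAt F (-(max (z - β * s) 0) / s ^ 2) s := by
  have hφ : ∀ s, 0 < s → HasDerivAt (fun s => z / s + β * (Real.log (β * s / z) - 1))
      (-(z - β * s) / s ^ 2) s := by
    intro s hs
    have h1 : HasDerivAt (fun s : ℝ => z / s) (-z / s ^ 2) s := by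
      have := (hasDerivAt_inv hs.ne').const_mul z
      simp only [div_eq_mul_inv]
      exact this.congr_deriv (by ring)
    have h2 : HasDerivAt (fun s : ℝ => β * s / z) (β / z) s := by
      have := ((hasDerivAt_id s).const_mul β).div_const z
      simpa using this
    have h3 := ((h2.log (by positivity)).sub_const 1).const_mul β
    refine (h1.add h3).congr_deriv ?_
    field_simp
    ring
  have hφa : z / (z / β) + β * (Real.log (β * (z / β) / z) - 1) = 0 := by
    have e1 : β * (z / β) / z = 1 := by field_simp
    have e2 : z / (z / β) = β := by field_simp
    rw [e1, e2, Real.log_one]; ring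
  rcases lt_trichotomy s (z / β) with h | h | h
  · have h' : β * s < z := by rw [lt_div_iff₀ hβ] at h; linarith
    rw [max_eq_left (by linarith)]
    refine (hφ s hs).congr_of_eventuallyEq ?_
    filter_upwards [Iio_mem_nhds h] with t ht
    rw [hF, if_pos (Set.mem_Iio.1 ht)]
  · have h' : β * s = z := by rw [h]; field_simp
    have e0 : -(max (z - β * s) 0) / s ^ 2 = 0 := by simp [h']
    have e1 : -(z - β * s) / s ^ 2 = 0 := by simp [h']
    rw [e0]
    have hL : HasDerivWithinAt F 0 (Set.Iic s) s := by
      have := (hφ s hs).hasDerivWithinAt (s := Set.Iic s)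
      rw [e1] at this
      have key : ∀ t ∈ Set.Iic s, F t = z / t + β * (Real.log (β * t / z) - 1) := by
        intro t ht
        rcases lt_or_eq_of_le (Set.mem_Iic.1 ht) with ht | ht
        · rw [hF, if_pos (h ▸ ht)]
        · rw [hF, ht, h, if_neg (lt_irrefl _), hφa]
      exact this.congr key (key s (Set.mem_Iic.2 le_rfl))
    have hR : HasDerivWithinAt F 0 (Set.Ici s) s := by
      have key : ∀ t ∈ Set.Ici s, F t = 0 := by
        intro t ht
        rw [hF, if_neg (not_lt.2 (h ▸ ht))]
      exact (hasDerivWithinAt_const s (Set.Ici s) (0 : ℝ)).congr key (key s (Set.mem_Ici.2 le_rfl))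
    have := hL.union hR
    rwa [Set.Iic_union_Ici, hasDerivWithinAt_univ] at this
  · have h' : z < β * s := by rw [div_lt_iff₀ hβ] at h; linarith
    rw [max_eq_right (by linarith)]
    simp only [neg_zero, zero_div]
    refine (hasDerivAt_const s (0 : ℝ)).congr_of_eventuallyEq ?_
    filter_upwards [Ioi_mem_nhds h] with t ht
    rw [hF, if_neg (not_lt.2 (le_of_lt ht))]

/-- Sign structure of a convex function which is negative somewhere and positive later. -/
lemma convex_sign (h : ℝ → ℝ) (hc : ConvexOn ℝ Set.univ h) (hcont : Continuous h)
    (h0 : h 0 ≤ 0) (c M : ℝ) (hc0 : 0 < c) (hcM : c ≤ M) (hhc : h c < 0) (hM : 0 < h M) :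
    ∃ s, 0 < s ∧ h s = 0 ∧ (∀ t, 0 < t → t < s → h t < 0) ∧ ∀ t, s < t → 0 < h t := by
  have conv : ∀ x y z : ℝ, x < y → y < z → (z - x) * h y ≤ (z - y) * h x + (y - x) * h z := by
    intro x y z hxy hyz
    have := hc.2 (Set.mem_univ x) (Set.mem_univ z) (show 0 ≤ (z - y) / (z - x) from div_nonneg (by linarith) (by linarith))
      (show 0 ≤ (y - x) / (z - x) from div_nonneg (by linarith) (by linarith))
      (by have : z - x ≠ 0 := by linarith
          field_simp
          ring)
    have hzx : 0 < z - x := by linarith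
    have e : ((z - y) / (z - x)) • x + ((y - x) / (z - x)) • z = y := by
      simp only [smul_eq_mul]
      have := hzx.ne'
      field_simp
      ring
    rw [e] at this
    simp only [smul_eq_mul] at this
    calc (z - x) * h y ≤ (z - x) * ((z - y) / (z - x) * h x + (y - x) / (z - x) * h z) :=
          mul_le_mul_of_nonneg_left this hzx.le
      _ = _ := by have := hzx.ne'
                  field_simp
  obtain ⟨s, ⟨hs1, hs2⟩, hs⟩ := intermediate_value_Icc hcM hcont.continuousOn ⟨hhc.le, hM.le⟩
  have hcs : c < s := lt_of_le_of_ne hs1 (by rintro rfl; linarith)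
  refine ⟨s, by linarith, hs, ?_, ?_⟩
  · intro t ht hts
    rcases lt_trichotomy t c with h1 | h1 | h1
    · have := conv 0 t c ht h1
      by_contra hn
      push Not at hn
      nlinarith [mul_pos ht (neg_pos.2 hhc), mul_nonneg (sub_pos.2 h1).le (neg_nonneg.2 h0),
        mul_nonneg hc0.le hn]
    · rw [h1]; exact hhc
    · have := conv c t s h1 hts
      rw [hs] at this
      by_contra hn
      push Not at hn
      nlinarith [mul_pos (sub_pos.2 hts) (neg_pos.2 hhc), mul_nonneg (sub_pos.2 hcs).le hn]
  · intro t ht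
    have := conv c s t hcs ht
    rw [hs] at this
    by_contra hn
    push Not at hn
    nlinarith [mul_pos (sub_pos.2 ht) (neg_pos.2 hhc),
      mul_nonneg (sub_pos.2 hcs).le (neg_nonneg.2 hn)]

/-- if `d̂₁ < d̂*` or `d2/β − d̂₁ < 0`, then `G` has a unique global minimizer on `(0,∞)`, which is also its unique stationary point. -/
theorem G_unique_global_min
    (β : ℝ) (hβ : 0 < β) (d2 : ℕ) (hd2 : 1 ≤ d2)
    (d1h dsh : ℕ) (hd1h : 1 ≤ d1h) (hd1s : d1h ≤ dsh)
    (ζ : ℕ → ℝ) (hζpos : ∀ i < dsh, 0 < ζ i)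
    (hζmono : ∀ i j, i ≤ j → j < dsh → ζ j ≤ ζ i)
    (Ffun : ℕ → ℝ → ℝ)
    (hFfun : ∀ i (s : ℝ), Ffun i s = if s < ζ i ^ 2 / β
        then ζ i ^ 2 / s + β * (Real.log (β * s / ζ i ^ 2) - 1) else 0)
    (G : ℝ → ℝ)
    (hG : ∀ s : ℝ, G s = (1 / (2 * s)) * ∑ i ∈ Finset.range dsh, ζ i ^ 2
        - (1 / 2) * ∑ i ∈ Finset.range d1h, Ffun i s
        + ((d2 : ℝ) / 2) * Real.log s)
    :
    (d1h < dsh ∨ (d2 : ℝ) / β - (d1h : ℝ) < 0) →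
    ∃ s : ℝ, 0 < s ∧ (∀ t : ℝ, 0 < t → G s ≤ G t) ∧ deriv G s = 0
      ∧ (∀ t : ℝ, 0 < t → deriv G t = 0 → t = s)
      ∧ (∀ t : ℝ, 0 < t → (∀ u : ℝ, 0 < u → G t ≤ G u) → t = s) := by
  intro hyp
  set S := ∑ i ∈ Finset.range dsh, ζ i ^ 2 with hS
  set T := ∑ i ∈ Finset.range d1h, ζ i ^ 2 with hT
  have hd2' : (1 : ℝ) ≤ d2 := by exact_mod_cast hd2
  have hSnn : 0 ≤ S := Finset.sum_nonneg fun i _ => sq_nonneg _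
  have hTS : T ≤ S := Finset.sum_le_sum_of_subset_of_nonneg
    (Finset.range_subset_range.2 hd1s) fun i _ _ => sq_nonneg _
  let h : ℝ → ℝ := fun t => -S + ∑ i ∈ Finset.range d1h, max (ζ i ^ 2 - β * t) 0 + d2 * t
  have hdef : ∀ t, h t = -S + ∑ i ∈ Finset.range d1h, max (ζ i ^ 2 - β * t) 0 + d2 * t :=
    fun t => rfl
  have hder : ∀ t, 0 < t → HasDerivAt G (h t / (2 * t ^ 2)) t := by
    intro t ht
    have hF : HasDerivAt (fun s => ∑ i ∈ Finset.range d1h, Ffun i s)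
        (∑ i ∈ Finset.range d1h, (-(max (ζ i ^ 2 - β * t) 0) / t ^ 2)) t := by
      refine HasDerivAt.fun_sum fun i hi => ?_
      have hi' := hζpos i (lt_of_lt_of_le (Finset.mem_range.1 hi) hd1s)
      exact hasDerivAt_F β (ζ i ^ 2) hβ (by positivity) (Ffun i) (hFfun i) t ht
    have h1 : HasDerivAt (fun s : ℝ => 1 / (2 * s) * S) (-S / (2 * t ^ 2)) t := by
      have := (hasDerivAt_inv ht.ne').const_mul (S / 2)
      have e : (fun s : ℝ => 1 / (2 * s) * S) = fun y => S / 2 * y⁻¹ := by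
        funext s
        simp only [one_div, mul_inv]
        ring
      rw [e]
      exact this.congr_deriv (by field_simp)
    have h2 := (Real.hasDerivAt_log ht.ne').const_mul ((d2 : ℝ) / 2)
    have h3 := (h1.sub (hF.const_mul (1 / 2))).add h2
    have hGe : G = fun s => 1 / (2 * s) * S - 1 / 2 * ∑ i ∈ Finset.range d1h, Ffun i s
        + (d2 : ℝ) / 2 * Real.log s := funext hG
    rw [hGe]
    refine h3.congr_deriv ?_
    rw [hdef, ← Finset.sum_div, Finset.sum_neg_distrib]
    field_simp
    ring
  have hconv : ConvexOn ℝ Set.univ h := by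
    refine ⟨convex_univ, fun x _ y _ a b ha hb hab => ?_⟩
    simp only [smul_eq_mul, hdef]
    have key : ∑ i ∈ Finset.range d1h, max (ζ i ^ 2 - β * (a * x + b * y)) 0 ≤
        a * ∑ i ∈ Finset.range d1h, max (ζ i ^ 2 - β * x) 0
        + b * ∑ i ∈ Finset.range d1h, max (ζ i ^ 2 - β * y) 0 := by
      rw [Finset.mul_sum, Finset.mul_sum, ← Finset.sum_add_distrib]
      refine Finset.sum_le_sum fun i _ => max_le ?_ (by positivity)
      have h1 := mul_le_mul_of_nonneg_left (le_max_left (ζ i ^ 2 - β * x) 0) ha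
      have h2 := mul_le_mul_of_nonneg_left (le_max_left (ζ i ^ 2 - β * y) 0) hb
      have e : ζ i ^ 2 = (a + b) * ζ i ^ 2 := by rw [hab, one_mul]
      linarith
    have e : S = (a + b) * S := by rw [hab, one_mul]
    linarith
  have hcont : Continuous h := by
    refine (continuous_const.add (continuous_finsetSum _ fun i _ => ?_)).add (by fun_prop)
    fun_prop
  have h00 : h 0 = -S + T := by
    rw [hdef, hT]
    simp only [mul_zero, sub_zero, add_zero]
    congr 1
    exact Finset.sum_congr rfl fun i _ => max_eq_left (sq_nonneg _)
  have hc : ∃ c, 0 < c ∧ h c < 0 := by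
    rcases hyp with hlt | hlt
    · have hTS' : T < S := by
        refine Finset.sum_lt_sum_of_subset (Finset.range_subset_range.2 hd1s)
          (Finset.mem_range.2 hlt) (by simp) (pow_pos (hζpos _ hlt) 2) fun i _ _ => sq_nonneg _
      have hcp : 0 < (S - T) / (2 * d2) := div_pos (by linarith) (by linarith)
      refine ⟨(S - T) / (2 * d2), hcp, ?_⟩
      have h1 : ∑ i ∈ Finset.range d1h, max (ζ i ^ 2 - β * ((S - T) / (2 * d2))) 0 ≤ T :=
        Finset.sum_le_sum fun i _ => max_le
          (by have := mul_pos hβ hcp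
              linarith) (sq_nonneg _)
      have h2 : (d2 : ℝ) * ((S - T) / (2 * d2)) = (S - T) / 2 := by field_simp
      rw [hdef, h2]
      linarith
    · have hz := hζpos (d1h - 1) (by omega)
      have hcp : 0 < ζ (d1h - 1) ^ 2 / β := by positivity
      refine ⟨ζ (d1h - 1) ^ 2 / β, hcp, ?_⟩
      set c := ζ (d1h - 1) ^ 2 / β with hcdef
      have hbc : β * c = ζ (d1h - 1) ^ 2 := by rw [hcdef]; field_simp
      have h1 : ∑ i ∈ Finset.range d1h, max (ζ i ^ 2 - β * c) 0 = T - d1h * (β * c) := by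
        have : ∑ i ∈ Finset.range d1h, max (ζ i ^ 2 - β * c) 0
            = ∑ i ∈ Finset.range d1h, (ζ i ^ 2 - β * c) := by
          refine Finset.sum_congr rfl fun i hi => max_eq_left ?_
          have hi := Finset.mem_range.1 hi
          have := hζmono i (d1h - 1) (by omega) (by omega)
          rw [hbc, sub_nonneg]
          exact pow_le_pow_left₀ hz.le this 2
        rw [this, Finset.sum_sub_distrib]
        simp [hT]
      have h2 : (d2 : ℝ) < d1h * β := by
        rw [sub_neg, div_lt_iff₀ hβ] at hlt
        exact hlt
      rw [hdef, h1]
      have := mul_lt_mul_of_pos_right h2 hcp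
      linarith
  obtain ⟨c, hc0, hhc⟩ := hc
  have hM : 0 < h (S + c) := by
    have h1 : 0 ≤ ∑ i ∈ Finset.range d1h, max (ζ i ^ 2 - β * (S + c)) 0 :=
      Finset.sum_nonneg fun i _ => le_max_right _ _
    rw [hdef]
    nlinarith
  obtain ⟨s, hs0, hs, hneg, hpos⟩ := convex_sign h hconv hcont (by rw [h00]; linarith) c (S + c)
    hc0 (by linarith) hhc hM
  have hanti : StrictAntiOn G (Set.Ioc 0 s) := by
    refine strictAntiOn_of_deriv_neg (convex_Ioc 0 s)
      (fun t ht => (hder t ht.1).continuousAt.continuousWithinAt) fun t ht => ?_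
    rw [interior_Ioc] at ht
    rw [(hder t ht.1).deriv]
    have := ht.1
    exact div_neg_of_neg_of_pos (hneg t ht.1 ht.2) (by positivity)
  have hmono : StrictMonoOn G (Set.Ici s) := by
    refine strictMonoOn_of_deriv_pos (convex_Ici s)
      (fun t ht => (hder t (lt_of_lt_of_le hs0 ht)).continuousAt.continuousWithinAt) fun t ht => ?_
    rw [interior_Ici] at ht
    have ht0 : 0 < t := lt_trans hs0 ht
    rw [(hder t ht0).deriv]
    exact div_pos (hpos t ht) (by positivity)
  have hlt : ∀ t, 0 < t → t ≠ s → G s < G t := by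
    intro t ht hne
    rcases lt_or_gt_of_ne hne with h1 | h1
    · exact hanti ⟨ht, h1.le⟩ ⟨hs0, le_rfl⟩ h1
    · exact hmono (Set.mem_Ici.2 le_rfl) (Set.mem_Ici.2 h1.le) h1
  refine ⟨s, hs0, ?_, ?_, ?_, ?_⟩
  · intro t ht
    by_cases hts : t = s
    · rw [hts]
    · exact (hlt t ht hts).le
  · rw [(hder s hs0).deriv, hs, zero_div]
  · intro t ht h1
    rw [(hder t ht).deriv] at h1
    have h2 : h t = 0 := by
      rcases div_eq_zero_iff.1 h1 with h2 | h2
      · exact h2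
      · have : 0 < 2 * t ^ 2 := by positivity
        linarith
    rcases lt_trichotomy t s with h3 | h3 | h3
    · linarith [hneg t ht h3]
    · exact h3
    · linarith [hpos t h3]
  · intro t ht h1
    by_contra hne
    linarith [hlt t ht hne, h1 s hs0]
end

section
/- Assume d̂_1 < d̂* or d2/β − d̂_1 < 0, so that G has a unique global minimizer s* ∈ (0,∞), and set s_{d̂_1} = ζ_{d̂_1}²/β. Then s* = ( Σ_{i=d̂_1+1}^{d̂*} ζ_i² ) / ( d2 − β d̂_1 ) and s* lies in the interval (0, s_{d̂_1}) — i.e. no posterior collapse occurs — if and only if β < d2 ζ_{d̂_1}² / ( d̂_1 ζ_{d̂_1}² + Σ_{i=d̂_1+1}^{d̂*} ζ_i² ). -/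
open BigOperators

/-- the optimal decoder variance equals `(Σ_{i>d̂₁} ζ_i²)/(d2 − β d̂₁)` and lies in `(0, s_{d̂₁})` (no posterior collapse) iff `β < d2 ζ_{d̂₁}² / (d̂₁ ζ_{d̂₁}² + Σ_{i>d̂₁} ζ_i²)` (0-based indexing of `ζ`). -/
theorem G_no_collapse_condition
    (β : ℝ) (hβ : 0 < β) (d2 : ℕ) (hd2 : 1 ≤ d2)
    (d1h dsh : ℕ) (hd1h : 1 ≤ d1h) (hd1s : d1h ≤ dsh)
    (ζ : ℕ → ℝ) (hζpos : ∀ i < dsh, 0 < ζ i)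
    (hζmono : ∀ i j, i ≤ j → j < dsh → ζ j ≤ ζ i)
    (Ffun : ℕ → ℝ → ℝ)
    (hFfun : ∀ i (s : ℝ), Ffun i s = if s < ζ i ^ 2 / β
        then ζ i ^ 2 / s + β * (Real.log (β * s / ζ i ^ 2) - 1) else 0)
    (G : ℝ → ℝ)
    (hG : ∀ s : ℝ, G s = (1 / (2 * s)) * ∑ i ∈ Finset.range dsh, ζ i ^ 2
        - (1 / 2) * ∑ i ∈ Finset.range d1h, Ffun i s
        + ((d2 : ℝ) / 2) * Real.log s)
    :
    (d1h < dsh ∨ (d2 : ℝ) / β - (d1h : ℝ) < 0) →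
    ∀ s : ℝ, 0 < s → (∀ t : ℝ, 0 < t → G s ≤ G t) →
      ((s = (∑ i ∈ Finset.Ico d1h dsh, ζ i ^ 2) / ((d2 : ℝ) - β * (d1h : ℝ))
          ∧ s < ζ (d1h - 1) ^ 2 / β)
        ↔ β < (d2 : ℝ) * ζ (d1h - 1) ^ 2
            / ((d1h : ℝ) * ζ (d1h - 1) ^ 2 + ∑ i ∈ Finset.Ico d1h dsh, ζ i ^ 2)) := by
  intro hcase s hs hmin
  set T := ∑ i ∈ Finset.Ico d1h dsh, ζ i ^ 2 with hT
  set z := ζ (d1h - 1) with hz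
  have hzpos : 0 < z := hζpos _ (by omega)
  have hz2 : 0 < z ^ 2 := by positivity
  have hd1pos : (0 : ℝ) < d1h := by exact_mod_cast hd1h
  have hT0 : 0 ≤ T := Finset.sum_nonneg fun i _ => sq_nonneg _
  have hden : 0 < (d1h : ℝ) * z ^ 2 + T := by positivity
  rw [lt_div_iff₀ hden, lt_div_iff₀ hβ]
  constructor
  · rintro ⟨h1, h2⟩
    have hTpos : T ≠ 0 := by
      intro h
      rw [h, zero_div] at h1
      linarith
    have hTp : 0 < T := lt_of_le_of_ne hT0 (Ne.symm hTpos)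
    have hK : 0 < (d2 : ℝ) - β * d1h := by
      by_contra hK
      have := div_nonpos_of_nonneg_of_nonpos hT0 (not_lt.mp hK)
      linarith
    have h3 : s * ((d2 : ℝ) - β * d1h) = T := by
      rw [h1]; field_simp
    nlinarith [mul_lt_mul_of_pos_right h2 hK]
  · intro h
    have hK : 0 < (d2 : ℝ) - β * d1h := by
      have : 0 < ((d2 : ℝ) - β * d1h) * z ^ 2 := by
        nlinarith [mul_nonneg hβ.le hT0]
      exact pos_of_mul_pos_left this hz2.le
    have hlt : d1h < dsh := by
      rcases hcase with h1 | h1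
      · exact h1
      · exfalso
        have : (d2 : ℝ) / β < d1h := by linarith
        rw [div_lt_iff₀ hβ] at this
        linarith
    have hTp : 0 < T := by
      apply Finset.sum_pos
      · intro i hi
        have := hζpos i (Finset.mem_Ico.mp hi).2
        positivity
      · exact ⟨d1h, Finset.mem_Ico.mpr ⟨le_refl _, hlt⟩⟩
    obtain ⟨K, hKdef⟩ : ∃ K, K = (d2 : ℝ) - β * d1h := ⟨_, rfl⟩
    rw [← hKdef] at hK ⊢
    obtain ⟨t, htdef⟩ : ∃ t, t = T / K := ⟨_, rfl⟩
    have htpos : 0 < t := by rw [htdef]; positivity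
    have htK : T = t * K := by rw [htdef]; field_simp
    have htz : t * β < z ^ 2 := by
      have : (t * β) * K < z ^ 2 * K := by
        have : (t * β) * K = β * T := by rw [htK]; ring
        rw [this, hKdef]; nlinarith
      exact lt_of_mul_lt_mul_right this hK.le
    rw [← htdef]
    suffices hst : s = t by exact ⟨hst, hst ▸ htz⟩
    by_contra hne
    have hle := hmin t htpos
    set Q := ∑ i ∈ Finset.range d1h, ζ i ^ 2 with hQ
    have hS : ∑ i ∈ Finset.range dsh, ζ i ^ 2 = Q + T :=
      (Finset.sum_range_add_sum_Ico _ hd1s).symm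
    obtain ⟨C, hC⟩ : ∃ C, C = ∑ i ∈ Finset.range d1h, β * (Real.log (β / ζ i ^ 2) - 1) :=
      ⟨_, rfl⟩
    have hP : ∀ x : ℝ, 0 < x → ∑ i ∈ Finset.range d1h,
        (ζ i ^ 2 / x + β * (Real.log (β * x / ζ i ^ 2) - 1))
        = Q / x + β * d1h * Real.log x + C := by
      intro x hx
      have : ∀ i ∈ Finset.range d1h, (ζ i ^ 2 / x + β * (Real.log (β * x / ζ i ^ 2) - 1))
          = ζ i ^ 2 / x + β * Real.log x + β * (Real.log (β / ζ i ^ 2) - 1) := by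
        intro i hi
        have hp := hζpos i (lt_of_lt_of_le (Finset.mem_range.mp hi) hd1s)
        have : β * x / ζ i ^ 2 = x * (β / ζ i ^ 2) := by ring
        rw [this, Real.log_mul hx.ne' (by positivity)]
        ring
      rw [Finset.sum_congr rfl this, Finset.sum_add_distrib, Finset.sum_add_distrib,
        ← Finset.sum_div, ← hC]
      simp
      ring
    have hFt : ∑ i ∈ Finset.range d1h, Ffun i t = Q / t + β * d1h * Real.log t + C := by
      rw [← hP t htpos]
      apply Finset.sum_congr rfl
      intro i hi
      have hi' := Finset.mem_range.mp hi
      have hm : z ≤ ζ i := hζmono i (d1h - 1) (by omega) (by omega)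
      rw [hFfun, if_pos]
      rw [lt_div_iff₀ hβ]
      nlinarith
    have hFs : ∑ i ∈ Finset.range d1h, Ffun i s ≤ Q / s + β * d1h * Real.log s + C := by
      rw [← hP s hs]
      apply Finset.sum_le_sum
      intro i hi
      have hp := hζpos i (lt_of_lt_of_le (Finset.mem_range.mp hi) hd1s)
      rw [hFfun]
      split_ifs with hc
      · exact le_refl _
      · have h1 : Real.log (ζ i ^ 2 / (β * s)) ≤ ζ i ^ 2 / (β * s) - 1 :=
          Real.log_le_sub_one_of_pos (by positivity)
        have h2 : β * s / ζ i ^ 2 = (ζ i ^ 2 / (β * s))⁻¹ := by rw [inv_div]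
        have h3 : ζ i ^ 2 / s = β * (ζ i ^ 2 / (β * s)) := by field_simp
        rw [h2, Real.log_inv, h3]
        nlinarith [mul_le_mul_of_nonneg_left h1 hβ.le]
    have hlog : Real.log (t / s) < t / s - 1 :=
      Real.log_lt_sub_one_of_pos (by positivity)
        (by intro h; rw [div_eq_one_iff_eq hs.ne'] at h; exact hne h.symm)
    rw [Real.log_div htpos.ne' hs.ne'] at hlog
    rw [hG, hG, hS, hFt] at hle
    have e1 : 1 / (2 * s) * (Q + T) = Q / s / 2 + K * (t / s) / 2 := by
      rw [htK]; field_simp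
    have e2 : 1 / (2 * t) * (Q + T) = Q / t / 2 + K / 2 := by
      rw [htK]; field_simp
    rw [e1, e2] at hle
    have hd : (d2 : ℝ) = K + β * d1h := by rw [hKdef]; ring
    rw [hd] at hle
    have := mul_lt_mul_of_pos_left hlog hK
    nlinarith
end

section
/- Assume d̂_1 < d̂* or d2/β − d̂_1 < 0, so that G has a unique global minimizer s* ∈ (0,∞), and set s_q = ζ_q²/β for 1 ≤ q ≤ d̂_1. Then for each integer p with 1 ≤ p < d̂_1: s* = ( Σ_{i=p+1}^{d̂*} ζ_i² ) / ( d2 − β p ) and s* lies in [s_{p+1}, s_p) — i.e. exactly the first p modes do not collapse — if and only if d2 ζ_{p+1}² / ( Σ_{i=p+2}^{d̂*} ζ_i² + (p+1) ζ_{p+1}² ) ≤ β < d2 ζ_p² / ( Σ_{i=p+1}^{d̂*} ζ_i² + p ζ_p² ). -/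
open BigOperators


lemma aux_F_deriv (β z : ℝ) (hβ : 0 < β) (hz : 0 < z) (f : ℝ → ℝ)
    (hf : ∀ s, f s = if s < z / β then z / s + β * (Real.log (β * s / z) - 1) else 0)
    (s : ℝ) (hs : 0 < s) : HasDerivAt f (-(max (z - β * s) 0) / s ^ 2) s := by
  have h1 : ∀ s : ℝ, 0 < s →
      HasDerivAt (fun s => z / s + β * (Real.log (β * s / z) - 1)) (-(z - β * s) / s ^ 2) s := by
    intro s hs
    have a1 : HasDerivAt (fun s : ℝ => β * s / z) (β / z) s := by
      simpa using ((hasDerivAt_id s).const_mul β).div_const z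
    have a2 := a1.log (by positivity)
    have a3 := ((hasDerivAt_inv hs.ne').const_mul z).add ((a2.sub_const 1).const_mul β)
    have a4 : (fun s => z / s + β * (Real.log (β * s / z) - 1))
        = ((fun y => z * y⁻¹) + fun y => β * (Real.log (β * y / z) - 1)) := by
      funext y
      simp [div_eq_mul_inv]
    rw [a4]
    refine a3.congr_deriv ?_
    field_simp
    ring
  rcases lt_trichotomy s (z / β) with h | h | h
  · have hm : max (z - β * s) 0 = z - β * s := by
      apply max_eq_left
      rw [lt_div_iff₀ hβ] at h
      linarith
    rw [hm]
    apply (h1 s hs).congr_of_eventuallyEq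
    filter_upwards [Iio_mem_nhds h] with y hy
    rw [hf, if_pos (show y < z / β from hy)]
  · have hzs : z - β * s = 0 := by
      rw [h]; field_simp; ring
    have hfs : f s = 0 := by rw [hf, if_neg (by rw [h]; exact lt_irrefl _)]
    have hd := h1 s hs
    rw [hzs] at hd ⊢
    simp only [max_self, neg_zero, zero_div] at hd ⊢
    have e1 : HasDerivWithinAt f 0 (Set.Iic s) s := by
      refine hd.hasDerivWithinAt.congr ?_ ?_
      · intro y hy
        rcases lt_or_eq_of_le (show y ≤ s from hy) with hy | hy
        · rw [hf, if_pos (by rw [← h]; exact hy)]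
        · rw [hy, hfs, show β * s = z by linarith, div_self hz.ne', Real.log_one]
          have : z / s = β := by rw [h]; field_simp
          rw [this]; ring
      · rw [hfs, show β * s = z by linarith, div_self hz.ne', Real.log_one]
        have : z / s = β := by rw [h]; field_simp
        rw [this]; ring
    have e2 : HasDerivWithinAt f 0 (Set.Ici s) s := by
      refine (hasDerivWithinAt_const s (Set.Ici s) (0 : ℝ)).congr ?_ hfs
      intro y hy
      rw [hf, if_neg (by rw [← h]; exact not_lt.mpr hy)]
    have := e1.union e2
    rwa [Set.Iic_union_Ici, hasDerivWithinAt_univ] at this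
  · have hm : max (z - β * s) 0 = 0 := by
      apply max_eq_right
      rw [div_lt_iff₀ hβ] at h
      linarith
    rw [hm]
    simp only [neg_zero, zero_div]
    apply (hasDerivAt_const s (0 : ℝ)).congr_of_eventuallyEq
    filter_upwards [Ioi_mem_nhds h] with y hy
    rw [hf, if_neg (not_lt.mpr (le_of_lt hy))]

lemma aux_convex (β z e a b : ℝ) (h1 : e < a) (h2 : a < b) :
    (b - e) * max (z - β * a) 0 ≤ (b - a) * max (z - β * e) 0 + (a - e) * max (z - β * b) 0 := by
  have i1 := mul_le_mul_of_nonneg_left (le_max_left (z - β * e) 0) (sub_pos.2 h2).le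
  have i2 := mul_le_mul_of_nonneg_left (le_max_left (z - β * b) 0) (sub_pos.2 h1).le
  have i3 := mul_le_mul_of_nonneg_left (le_max_right (z - β * e) 0) (sub_pos.2 h2).le
  have i4 := mul_le_mul_of_nonneg_left (le_max_right (z - β * b) 0) (sub_pos.2 h1).le
  rcases max_cases (z - β * a) 0 with ⟨h, _⟩ | ⟨h, _⟩ <;> rw [h] <;> nlinarith

lemma aux_unique (β d T : ℝ) (n : ℕ) (z : ℕ → ℝ) (e a b : ℝ) (h1 : e < a) (h2 : a < b)
    (he : d * e - T + ∑ i ∈ Finset.range n, max (z i - β * e) 0 < 0)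
    (ha : d * a - T + ∑ i ∈ Finset.range n, max (z i - β * a) 0 = 0)
    (hb : d * b - T + ∑ i ∈ Finset.range n, max (z i - β * b) 0 = 0) : False := by
  have hc : (b - e) * ∑ i ∈ Finset.range n, max (z i - β * a) 0
      ≤ (b - a) * ∑ i ∈ Finset.range n, max (z i - β * e) 0
        + (a - e) * ∑ i ∈ Finset.range n, max (z i - β * b) 0 := by
    rw [Finset.mul_sum, Finset.mul_sum, Finset.mul_sum, ← Finset.sum_add_distrib]
    exact Finset.sum_le_sum fun i _ => aux_convex β (z i) e a b h1 h2
  have := mul_neg_of_pos_of_neg (sub_pos.2 h2) he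
  have hA : ∑ i ∈ Finset.range n, max (z i - β * a) 0 = T - d * a := by linarith
  have hB : ∑ i ∈ Finset.range n, max (z i - β * b) 0 = T - d * b := by linarith
  rw [hA, hB] at hc
  nlinarith

/-- partial collapse — the optimal decoder variance equals `(Σ_{i>p} ζ_i²)/(d2 − β p)` and lies in `[s_{p+1}, s_p)` (exactly the first `p` modes survive) iff the stated two-sided condition on `β` holds (0-based indexing of `ζ`). -/
theorem G_partial_collapse_condition
    (β : ℝ) (hβ : 0 < β) (d2 : ℕ) (hd2 : 1 ≤ d2)
    (d1h dsh : ℕ) (hd1h : 1 ≤ d1h) (hd1s : d1h ≤ dsh)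
    (ζ : ℕ → ℝ) (hζpos : ∀ i < dsh, 0 < ζ i)
    (hζmono : ∀ i j, i ≤ j → j < dsh → ζ j ≤ ζ i)
    (Ffun : ℕ → ℝ → ℝ)
    (hFfun : ∀ i (s : ℝ), Ffun i s = if s < ζ i ^ 2 / β
        then ζ i ^ 2 / s + β * (Real.log (β * s / ζ i ^ 2) - 1) else 0)
    (G : ℝ → ℝ)
    (hG : ∀ s : ℝ, G s = (1 / (2 * s)) * ∑ i ∈ Finset.range dsh, ζ i ^ 2
        - (1 / 2) * ∑ i ∈ Finset.range d1h, Ffun i s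
        + ((d2 : ℝ) / 2) * Real.log s)
    :
    (d1h < dsh ∨ (d2 : ℝ) / β - (d1h : ℝ) < 0) →
    ∀ s : ℝ, 0 < s → (∀ t : ℝ, 0 < t → G s ≤ G t) →
      ∀ p : ℕ, 1 ≤ p → p < d1h →
        ((s = (∑ i ∈ Finset.Ico p dsh, ζ i ^ 2) / ((d2 : ℝ) - β * (p : ℝ))
            ∧ ζ p ^ 2 / β ≤ s ∧ s < ζ (p - 1) ^ 2 / β)
          ↔ ((d2 : ℝ) * ζ p ^ 2
                / ((∑ i ∈ Finset.Ico (p + 1) dsh, ζ i ^ 2) + ((p : ℝ) + 1) * ζ p ^ 2)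
              ≤ β
            ∧ β < (d2 : ℝ) * ζ (p - 1) ^ 2
                / ((∑ i ∈ Finset.Ico p dsh, ζ i ^ 2) + (p : ℝ) * ζ (p - 1) ^ 2))) := by
  intro hyp s hs hmin p hp1 hpd
  have hpds : p < dsh := by omega
  have hzp : 0 < ζ p ^ 2 := pow_pos (hζpos p hpds) 2
  have hzq : 0 < ζ (p - 1) ^ 2 := pow_pos (hζpos (p - 1) (by omega)) 2
  have hsq : ∀ i j, i ≤ j → j < dsh → ζ j ^ 2 ≤ ζ i ^ 2 := fun i j hij hj =>
    pow_le_pow_left₀ (hζpos j hj).le (hζmono i j hij hj) 2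
  have hS : ∑ i ∈ Finset.Ico p dsh, ζ i ^ 2
      = ζ p ^ 2 + ∑ i ∈ Finset.Ico (p + 1) dsh, ζ i ^ 2 := Finset.sum_eq_sum_Ico_succ_bot hpds _
  have hS1 : 0 ≤ ∑ i ∈ Finset.Ico (p + 1) dsh, ζ i ^ 2 :=
    Finset.sum_nonneg fun i _ => sq_nonneg _
  have hT : ∑ i ∈ Finset.range p, ζ i ^ 2 + ∑ i ∈ Finset.Ico p dsh, ζ i ^ 2
      = ∑ i ∈ Finset.range dsh, ζ i ^ 2 := Finset.sum_range_add_sum_Ico _ hpds.le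
  have hp0 : (0 : ℝ) < p := by exact_mod_cast hp1
  set S := ∑ i ∈ Finset.Ico p dsh, ζ i ^ 2 with hSdef
  set S' := ∑ i ∈ Finset.Ico (p + 1) dsh, ζ i ^ 2 with hSdef'
  have hSpos : 0 < S := by linarith
  have hA : 0 < S' + ((p : ℝ) + 1) * ζ p ^ 2 := by positivity
  have hB : 0 < S + (p : ℝ) * ζ (p - 1) ^ 2 := by positivity
  rw [div_le_iff₀ hA, lt_div_iff₀ hB]
  -- the algebraic equivalence once the denominator is positive
  have key : 0 < (d2 : ℝ) - β * p →
      ((ζ p ^ 2 / β ≤ S / ((d2 : ℝ) - β * p) ↔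
          (d2 : ℝ) * ζ p ^ 2 ≤ β * (S' + ((p : ℝ) + 1) * ζ p ^ 2)) ∧
        (S / ((d2 : ℝ) - β * p) < ζ (p - 1) ^ 2 / β ↔
          β * (S + (p : ℝ) * ζ (p - 1) ^ 2) < (d2 : ℝ) * ζ (p - 1) ^ 2)) := by
    intro hD
    rw [div_le_div_iff₀ hβ hD, div_lt_div_iff₀ hD hβ]
    constructor <;> constructor <;> intro h <;> nlinarith
  constructor
  · rintro ⟨h1, h2, h3⟩
    have hD : 0 < (d2 : ℝ) - β * p := by
      by_contra hneg
      have := div_nonpos_of_nonneg_of_nonpos hSpos.le (not_lt.1 hneg)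
      linarith
    rw [h1] at h2 h3
    exact ⟨(key hD).1.1 h2, (key hD).2.1 h3⟩
  · rintro ⟨h2, h3⟩
    have hD : 0 < (d2 : ℝ) - β * p := by
      have : 0 < β * S := by positivity
      have h4 : 0 < ((d2 : ℝ) - β * p) * ζ (p - 1) ^ 2 := by nlinarith
      exact pos_of_mul_pos_left h4 hzq.le
    have k2 := (key hD).1.2 h2
    have k3 := (key hD).2.2 h3
    suffices hss : s = S / ((d2 : ℝ) - β * p) by
      rw [hss]; exact ⟨rfl, k2, k3⟩
    set s0 := S / ((d2 : ℝ) - β * p) with hs0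
    have hs0pos : 0 < s0 := by positivity
    have hs0D : s0 * ((d2 : ℝ) - β * p) = S := by rw [hs0]; field_simp
    rw [div_le_iff₀ hβ] at k2
    rw [lt_div_iff₀ hβ] at k3
    set T := ∑ i ∈ Finset.range dsh, ζ i ^ 2 with hTdef
    -- s0 is a zero
    have hz0 : (d2 : ℝ) * s0 - T + ∑ i ∈ Finset.range d1h, max (ζ i ^ 2 - β * s0) 0 = 0 := by
      rw [← Finset.sum_range_add_sum_Ico _ hpd.le]
      have e1 : ∑ i ∈ Finset.range p, max (ζ i ^ 2 - β * s0) 0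
          = ∑ i ∈ Finset.range p, (ζ i ^ 2 - β * s0) := by
        apply Finset.sum_congr rfl
        intro i hi
        rw [Finset.mem_range] at hi
        have := hsq i (p - 1) (by omega) (by omega)
        exact max_eq_left (by linarith)
      have e2 : ∑ i ∈ Finset.Ico p d1h, max (ζ i ^ 2 - β * s0) 0 = 0 := by
        apply Finset.sum_eq_zero
        intro i hi
        rw [Finset.mem_Ico] at hi
        have := hsq p i hi.1 (by omega)
        exact max_eq_right (by linarith)
      rw [e1, e2, Finset.sum_sub_distrib]
      simp only [Finset.sum_const, Finset.card_range, nsmul_eq_mul]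
      linarith
    -- s is a zero
    have hzs : (d2 : ℝ) * s - T + ∑ i ∈ Finset.range d1h, max (ζ i ^ 2 - β * s) 0 = 0 := by
      have hFd : ∀ i ∈ Finset.range d1h,
          HasDerivAt (Ffun i) (-(max (ζ i ^ 2 - β * s) 0) / s ^ 2) s := by
        intro i hi
        rw [Finset.mem_range] at hi
        exact aux_F_deriv β (ζ i ^ 2) hβ (pow_pos (hζpos i (by omega)) 2) (Ffun i) (hFfun i) s hs
      have g1 := (HasDerivAt.fun_sum hFd).const_mul (1 / 2 : ℝ)
      have g2 : HasDerivAt (fun s : ℝ => (1 / (2 * s)) * T) (-T / (2 * s ^ 2)) s := by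
        have := (hasDerivAt_inv hs.ne').const_mul (T / 2)
        have hfe : (fun s : ℝ => (1 / (2 * s)) * T) = fun y => T / 2 * y⁻¹ := by
          funext y
          rw [one_div, mul_inv]; ring
        rw [hfe]
        refine this.congr_deriv ?_
        rw [div_eq_mul_inv, div_eq_mul_inv, mul_inv]; ring
      have g3 := (Real.hasDerivAt_log hs.ne').const_mul ((d2 : ℝ) / 2)
      have g4 := (g2.fun_sub g1).fun_add g3
      have hGe : G = fun s => (1 / (2 * s)) * T - (1 / 2) * ∑ i ∈ Finset.range d1h, Ffun i s
        + ((d2 : ℝ) / 2) * Real.log s := funext hG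
      rw [← hGe] at g4
      have hloc : IsLocalMin G s := by
        filter_upwards [Ioi_mem_nhds hs] with t ht
        exact hmin t ht
      have h0 := hloc.hasDerivAt_eq_zero g4
      rw [← Finset.sum_div, Finset.sum_neg_distrib] at h0
      generalize ∑ i ∈ Finset.range d1h, max (ζ i ^ 2 - β * s) 0 = M at h0 ⊢
      field_simp at h0
      linarith
    -- below any a > 0 there is a point where the function is negative
    have hneg : ∀ a : ℝ, 0 < a → ∃ e, e < a ∧
        (d2 : ℝ) * e - T + ∑ i ∈ Finset.range d1h, max (ζ i ^ 2 - β * e) 0 < 0 := by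
      intro a ha
      have hTd : ∑ i ∈ Finset.range d1h, ζ i ^ 2 + ∑ i ∈ Finset.Ico d1h dsh, ζ i ^ 2
          = T := Finset.sum_range_add_sum_Ico _ hd1s
      rcases hyp with hlt | hlt
      · refine ⟨0, ha, ?_⟩
        have e1 : ∑ i ∈ Finset.range d1h, max (ζ i ^ 2 - β * 0) 0
            = ∑ i ∈ Finset.range d1h, ζ i ^ 2 := by
          apply Finset.sum_congr rfl
          intro i _
          rw [mul_zero, sub_zero]
          exact max_eq_left (sq_nonneg _)
        have e2 : 0 < ∑ i ∈ Finset.Ico d1h dsh, ζ i ^ 2 := by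
          apply Finset.sum_pos
          · intro i hi
            rw [Finset.mem_Ico] at hi
            exact pow_pos (hζpos i hi.2) 2
          · exact Finset.nonempty_Ico.2 hlt
        rw [e1]
        linarith
      · have hzl : 0 < ζ (d1h - 1) ^ 2 := pow_pos (hζpos _ (by omega)) 2
        have hm1 := min_le_left (a / 2) (ζ (d1h - 1) ^ 2 / β)
        have hm2 := min_le_right (a / 2) (ζ (d1h - 1) ^ 2 / β)
        have hm0 : 0 < min (a / 2) (ζ (d1h - 1) ^ 2 / β) :=
          lt_min (by positivity) (by positivity)
        generalize min (a / 2) (ζ (d1h - 1) ^ 2 / β) = e at hm0 hm1 hm2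
        refine ⟨e, by linarith, ?_⟩
        rw [le_div_iff₀ hβ] at hm2
        have e1 : ∑ i ∈ Finset.range d1h, max (ζ i ^ 2 - β * e) 0
            = ∑ i ∈ Finset.range d1h, (ζ i ^ 2 - β * e) := by
          apply Finset.sum_congr rfl
          intro i hi
          rw [Finset.mem_range] at hi
          have := hsq i (d1h - 1) (by omega) (by omega)
          exact max_eq_left (by linarith)
        have e2 : 0 ≤ ∑ i ∈ Finset.Ico d1h dsh, ζ i ^ 2 :=
          Finset.sum_nonneg fun i _ => sq_nonneg _
        have e3 : (d2 : ℝ) < d1h * β := by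
          rw [sub_neg, div_lt_iff₀ hβ] at hlt
          exact hlt
        rw [e1, Finset.sum_sub_distrib]
        simp only [Finset.sum_const, Finset.card_range, nsmul_eq_mul]
        nlinarith
    rcases lt_trichotomy s s0 with h | h | h
    · obtain ⟨e, he, hne⟩ := hneg s hs
      exact (aux_unique β d2 T d1h (fun i => ζ i ^ 2) e s s0 he h hne hzs hz0).elim
    · exact h
    · obtain ⟨e, he, hne⟩ := hneg s0 hs0pos
      exact (aux_unique β d2 T d1h (fun i => ζ i ^ 2) e s0 s he h hne hz0 hzs).elim
end

section
/- Assume d̂_1 < d̂* or d2/β − d̂_1 < 0, so that G has a unique global minimizer s* ∈ (0,∞), and set s_1 = ζ_1²/β. Then s* = (1/d2) Σ_{i=1}^{d̂*} ζ_i² and s* ≥ s_1 — i.e. complete posterior collapse occurs — if and only if β ≥ d2 ζ_1² / ( Σ_{i=1}^{d̂*} ζ_i² ). -/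
open BigOperators

/-- Tangent-line inequality for `F` viewed as a convex function of `1/s`. -/
theorem F_tangent (β z s t : ℝ) (hβ : 0 < β) (hz : 0 < z) (hs : 0 < s) (ht : 0 < t) :
    (if s < z / β then z / s + β * (Real.log (β * s / z) - 1) else 0)
      + max (z - β * s) 0 * (1 / t - 1 / s)
    ≤ (if t < z / β then z / t + β * (Real.log (β * t / z) - 1) else 0) := by
  have hlog : ∀ u : ℝ, 0 < u → Real.log (β * u / z) = Real.log β + Real.log u - Real.log z := by
    intro u hu
    rw [Real.log_div (by positivity) hz.ne', Real.log_mul hβ.ne' hu.ne']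
  by_cases h1 : s < z / β
  · have h1' : β * s < z := by rw [lt_div_iff₀ hβ] at h1; linarith
    rw [if_pos h1, max_eq_left (by linarith)]
    have es : (z - β * s) * (1 / t - 1 / s) = z / t - z / s - β * (s / t) + β := by
      field_simp; ring
    rw [es]
    by_cases h2 : t < z / β
    · rw [if_pos h2, hlog s hs, hlog t ht]
      have h := Real.log_le_sub_one_of_pos (div_pos hs ht)
      rw [Real.log_div hs.ne' ht.ne'] at h
      nlinarith [mul_le_mul_of_nonneg_left h hβ.le]
    · rw [if_neg h2]
      have h2' : z ≤ β * t := by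
        rw [not_lt, div_le_iff₀ hβ] at h2; linarith
      have h := Real.log_le_sub_one_of_pos (show 0 < β * s / z by positivity)
      have h3 : (z - β * s) / t ≤ β * (1 - β * s / z) := by
        rw [div_le_iff₀ ht]
        have : β * (1 - β * s / z) * t = (z - β * s) * (β * t / z) := by
          field_simp
        rw [this]
        have h4 : 1 ≤ β * t / z := by rw [le_div_iff₀ hz]; linarith
        nlinarith
      have h5 : (z - β * s) / t = z / t - β * (s / t) := by ring
      nlinarith [mul_le_mul_of_nonneg_left h hβ.le]
  · have h1' : z ≤ β * s := by
      rw [not_lt, div_le_iff₀ hβ] at h1; linarith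
    rw [if_neg h1, max_eq_right (by linarith)]
    split_ifs with h2
    · have h := Real.one_sub_inv_le_log_of_pos (show 0 < β * t / z by positivity)
      have h3 : β * (β * t / z)⁻¹ = z / t := by field_simp
      nlinarith [mul_le_mul_of_nonneg_left h hβ.le]
    · simp

/-- First-order condition for `A / t + d log t`. -/
theorem foc (A d s : ℝ) (hs : 0 < s)
    (h : ∀ t : ℝ, 0 < t → A * s⁻¹ + d * Real.log s ≤ A * t⁻¹ + d * Real.log t) :
    A = d * s := by
  have hd : HasDerivAt (fun t : ℝ => A * t⁻¹ + d * Real.log t)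
      (A * (-(s ^ 2)⁻¹) + d * s⁻¹) s :=
    ((hasDerivAt_inv hs.ne').const_mul A).add ((Real.hasDerivAt_log hs.ne').const_mul d)
  have hm : IsLocalMin (fun t : ℝ => A * t⁻¹ + d * Real.log t) s := by
    filter_upwards [lt_mem_nhds hs] with t ht using h t ht
  have h0 := hm.hasDerivAt_eq_zero hd
  field_simp at h0
  linarith

/-- complete collapse — the optimal decoder variance equals `(1/d2) Σ_i ζ_i²` and is `≥ s_1 = ζ_1²/β` iff `β ≥ d2 ζ_1² / Σ_i ζ_i²` (0-based indexing of `ζ`). -/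
theorem G_complete_collapse_condition
    (β : ℝ) (hβ : 0 < β) (d2 : ℕ) (hd2 : 1 ≤ d2)
    (d1h dsh : ℕ) (hd1h : 1 ≤ d1h) (hd1s : d1h ≤ dsh)
    (ζ : ℕ → ℝ) (hζpos : ∀ i < dsh, 0 < ζ i)
    (hζmono : ∀ i j, i ≤ j → j < dsh → ζ j ≤ ζ i)
    (Ffun : ℕ → ℝ → ℝ)
    (hFfun : ∀ i (s : ℝ), Ffun i s = if s < ζ i ^ 2 / β
        then ζ i ^ 2 / s + β * (Real.log (β * s / ζ i ^ 2) - 1) else 0)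
    (G : ℝ → ℝ)
    (hG : ∀ s : ℝ, G s = (1 / (2 * s)) * ∑ i ∈ Finset.range dsh, ζ i ^ 2
        - (1 / 2) * ∑ i ∈ Finset.range d1h, Ffun i s
        + ((d2 : ℝ) / 2) * Real.log s)
    :
    (d1h < dsh ∨ (d2 : ℝ) / β - (d1h : ℝ) < 0) →
    ∀ s : ℝ, 0 < s → (∀ t : ℝ, 0 < t → G s ≤ G t) →
      ((s = (1 / (d2 : ℝ)) * ∑ i ∈ Finset.range dsh, ζ i ^ 2 ∧ ζ 0 ^ 2 / β ≤ s)
        ↔ (d2 : ℝ) * ζ 0 ^ 2 / (∑ i ∈ Finset.range dsh, ζ i ^ 2) ≤ β) := by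
  intro hcase s hs hmin
  have hd : (0 : ℝ) < d2 := by exact_mod_cast hd2
  have hz : ∀ i < dsh, 0 < ζ i ^ 2 := fun i hi => pow_pos (hζpos i hi) 2
  have hz0 : 0 < ζ 0 ^ 2 := hz 0 (by omega)
  have hle0 : ∀ i < dsh, ζ i ^ 2 ≤ ζ 0 ^ 2 := fun i hi =>
    pow_le_pow_left₀ (hζpos i hi).le (hζmono 0 i (Nat.zero_le i) hi) 2
  have hsub : Finset.range d1h ⊆ Finset.range dsh := Finset.range_subset_range.2 hd1s
  set S := ∑ i ∈ Finset.range dsh, ζ i ^ 2 with hS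
  have hSpos : 0 < S := by
    apply Finset.sum_pos (fun i hi => hz i (Finset.mem_range.1 hi))
    exact ⟨0, Finset.mem_range.2 (by omega)⟩
  constructor
  · rintro ⟨h1, h2⟩
    rw [h1, div_le_iff₀ hβ] at h2
    rw [div_le_iff₀ hSpos]
    have := mul_le_mul_of_nonneg_left h2 hd.le
    have e : (d2 : ℝ) * (1 / (d2 : ℝ) * S * β) = β * S := by field_simp
    linarith
  · intro hb
    rw [div_le_iff₀ hSpos] at hb
    set P := ∑ i ∈ Finset.range d1h, max (ζ i ^ 2 - β * s) 0 with hP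
    have hfoc : S - P = d2 * s := by
      apply foc _ _ _ hs
      intro t ht
      have h1 := hmin t ht
      have h2 : ∑ i ∈ Finset.range d1h, Ffun i s + P * (1 / t - 1 / s)
          ≤ ∑ i ∈ Finset.range d1h, Ffun i t := by
        rw [hP, Finset.sum_mul, ← Finset.sum_add_distrib]
        apply Finset.sum_le_sum
        intro i hi
        rw [hFfun i s, hFfun i t]
        exact F_tangent β _ s t hβ (hz i (Finset.mem_range.1 (hsub hi))) hs ht
      rw [hG s, hG t] at h1
      have e1 : ∀ u : ℝ, 1 / (2 * u) * S = 1 / 2 * (S * u⁻¹) := by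
        intro u; rw [one_div, mul_inv]; ring
      rw [e1, e1] at h1
      rw [one_div, one_div] at h2
      nlinarith
    have key : ζ 0 ^ 2 / β ≤ s := by
      by_contra hlt
      rw [not_le, lt_div_iff₀ hβ] at hlt
      obtain ⟨l, hl⟩ : ∃ l, l = β * s / ζ 0 ^ 2 := ⟨_, rfl⟩
      have hl0 : 0 < l := by rw [hl]; positivity
      have hl1 : l < 1 := by rw [hl, div_lt_one hz0]; linarith
      have hlz : l * ζ 0 ^ 2 = β * s := by rw [hl]; exact div_mul_cancel₀ _ hz0.ne'
      have hds : d2 * s ≤ l * S := by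
        have h1 := mul_le_mul_of_nonneg_left hb hl0.le
        have h2 : l * (d2 * ζ 0 ^ 2) = β * (d2 * s) := by
          calc l * (d2 * ζ 0 ^ 2) = d2 * (l * ζ 0 ^ 2) := by ring
            _ = _ := by rw [hlz]; ring
        rw [h2] at h1
        have h3 : β * (d2 * s) ≤ β * (l * S) := by linarith
        exact le_of_mul_le_mul_left h3 hβ
      have hpi : ∀ i ∈ Finset.range d1h,
          max (ζ i ^ 2 - β * s) 0 ≤ (1 - l) * ζ i ^ 2 := by
        intro i hi
        have hi' := Finset.mem_range.1 (hsub hi)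
        apply max_le
        · nlinarith [mul_le_mul_of_nonneg_left (hle0 i hi') hl0.le]
        · exact mul_nonneg (by linarith) (hz i hi').le
      have hPle := Finset.sum_le_sum hpi
      have hsumeq : ∑ i ∈ Finset.range d1h, (1 - l) * ζ i ^ 2
          = (1 - l) * ∑ i ∈ Finset.range d1h, ζ i ^ 2 := by rw [Finset.mul_sum]
      rcases Nat.lt_or_ge d1h dsh with hlt' | hge
      · have hstrict : ∑ i ∈ Finset.range d1h, ζ i ^ 2 < S := by
          apply Finset.sum_lt_sum_of_subset hsub (i := d1h) (Finset.mem_range.2 hlt') (by simp)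
            (hz d1h hlt')
          intro j hj _
          exact (hz j (Finset.mem_range.1 hj)).le
        have := mul_lt_mul_of_pos_left hstrict (sub_pos.2 hl1)
        rw [← hP, hsumeq] at hPle
        linarith
      · have heq : d1h = dsh := le_antisymm hd1s hge
        have hd1 : (d2 : ℝ) / β - d1h < 0 := by
          rcases hcase with h | h
          · omega
          · exact h
        have hS1 : ∑ i ∈ Finset.range d1h, ζ i ^ 2 = S := by rw [hS, heq]
        have hPeq : ∑ i ∈ Finset.range d1h, max (ζ i ^ 2 - β * s) 0
            = ∑ i ∈ Finset.range d1h, (1 - l) * ζ i ^ 2 := by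
          apply le_antisymm hPle
          rw [hsumeq, hS1, ← hP]
          linarith
        have hall := (Finset.sum_eq_sum_iff_of_le hpi).1 hPeq
        have hP2 : P = S - d1h * (β * s) := by
          have : P = ∑ i ∈ Finset.range d1h, (ζ i ^ 2 - β * s) := by
            rw [hP]
            apply Finset.sum_congr rfl
            intro i hi
            have h1 := hall i hi
            have h2 : 0 < (1 - l) * ζ i ^ 2 :=
              mul_pos (by linarith) (hz i (Finset.mem_range.1 (hsub hi)))
            rcases max_choice (ζ i ^ 2 - β * s) 0 with h | h
            · exact h
            · rw [h] at h1; linarith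
          rw [this, Finset.sum_sub_distrib, hS1]
          simp
        have h3 : (d2 : ℝ) < d1h * β := by
          rw [sub_neg, div_lt_iff₀ hβ] at hd1; exact hd1
        have h4 := mul_lt_mul_of_pos_right h3 hs
        linarith
    refine ⟨?_, key⟩
    rw [div_le_iff₀ hβ] at key
    have hP0 : P = 0 := by
      rw [hP]
      apply Finset.sum_eq_zero
      intro i hi
      apply max_eq_right
      have := hle0 i (Finset.mem_range.1 (hsub hi))
      linarith
    rw [hP0, sub_zero] at hfoc
    rw [hfoc]
    field_simp
end

section
/- Assume d̂_1 = d̂* (all positive singular-value modes fit within the latent dimension). (1) If β < d2/d̂_1, then G'(s) > 0 for all s ∈ (0, ∞); in particular G is strictly increasing and attains no minimum on (0, ∞), so the VAE objective with learnable decoder variance is ill-posed and the optimal decoder variance degenerates to 0. (2) If β = d2/d̂_1, then, with s_{d̂_1} = ζ_{d̂_1}²/β, G'(s) = 0 for all s ∈ (0, s_{d̂_1}] and G'(s) > 0 for all s > s_{d̂_1}; hence the set of global minimizers of G is exactly the interval (0, s_{d̂_1}]. -/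
open BigOperators

/-- Derivative of one mode of the objective. -/
theorem mode_hasDerivAt (β c s : ℝ) (hβ : 0 < β) (hc : 0 < c) (hs : 0 < s) :
    HasDerivAt (fun x : ℝ => c / x - (if x < c / β
        then c / x + β * (Real.log (β * x / c) - 1) else 0)) (-(min (β / s) (c / s ^ 2))) s := by
  have hA : HasDerivAt (fun x : ℝ => -(β * (Real.log (β * x / c) - 1))) (-(β / s)) s := by
    have h1 : HasDerivAt (fun x : ℝ => β * x / c) (β * 1 / c) s :=
      ((hasDerivAt_id s).const_mul β).div_const c
    have h2 := (((h1.log (by positivity)).sub_const 1).const_mul β).neg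
    refine h2.congr_deriv ?_
    field_simp
  have hB : HasDerivAt (fun x : ℝ => c / x) (-(c / s ^ 2)) s := by
    have h2 := (hasDerivAt_inv hs.ne').const_mul c
    have h3 : HasDerivAt (fun x : ℝ => c / x) (c * -(s ^ 2)⁻¹) s := by
      simpa [div_eq_mul_inv] using h2
    refine h3.congr_deriv ?_
    field_simp
  rcases lt_trichotomy s (c / β) with h | h | h
  · have hm : min (β / s) (c / s ^ 2) = β / s := by
      apply min_eq_left
      rw [lt_div_iff₀ hβ] at h
      rw [div_le_div_iff₀ hs (by positivity)]
      nlinarith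
    rw [hm]
    refine hA.congr_of_eventuallyEq ?_
    filter_upwards [Iio_mem_nhds h] with x hx
    rw [if_pos (Set.mem_Iio.1 hx)]; ring
  · have hbs : β * s = c := by rw [h]; field_simp
    have hcs : c / s ^ 2 = β / s := by rw [← hbs]; field_simp
    rw [hcs, min_self]
    rw [hcs] at hB
    have hval : Real.log (β * s / c) = 0 := by rw [hbs, div_self hc.ne', Real.log_one]
    have hl : HasDerivWithinAt (fun x : ℝ => c / x - (if x < c / β
        then c / x + β * (Real.log (β * x / c) - 1) else 0)) (-(β / s)) (Set.Iic s) s := by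
      refine hA.hasDerivWithinAt.congr (fun x hx => ?_) ?_
      · rcases lt_or_eq_of_le (Set.mem_Iic.1 hx) with h' | h'
        · rw [if_pos (h ▸ h')]; ring
        · rw [h', if_neg (by rw [← h]; exact lt_irrefl s), hval, ← hbs]; field_simp; ring
      · rw [if_neg (by rw [← h]; exact lt_irrefl s), hval, ← hbs]; field_simp; ring
    have hr : HasDerivWithinAt (fun x : ℝ => c / x - (if x < c / β
        then c / x + β * (Real.log (β * x / c) - 1) else 0)) (-(β / s)) (Set.Ici s) s := by
      refine hB.hasDerivWithinAt.congr (fun x hx => ?_) ?_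
      · rw [if_neg (by rw [← h]; exact not_lt.2 hx)]; ring
      · rw [if_neg (by rw [← h]; exact lt_irrefl s)]; ring
    have := hl.union hr
    rw [Set.Iic_union_Ici] at this
    exact hasDerivWithinAt_univ.1 this
  · have hm : min (β / s) (c / s ^ 2) = c / s ^ 2 := by
      apply min_eq_right
      rw [div_lt_iff₀ hβ] at h
      rw [div_le_div_iff₀ (by positivity) hs]
      nlinarith
    rw [hm]
    refine hB.congr_of_eventuallyEq ?_
    filter_upwards [Ioi_mem_nhds h] with x hx
    rw [if_neg (not_lt.2 (le_of_lt hx))]; ring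

/-- when `d̂₁ = d̂*`: (1) if `β < d2/d̂₁` then `G´ > 0` on `(0,∞)`, `G` is strictly increasing, and `G` attains no minimum; (2) if `β = d2/d̂₁` then `G´ = 0` on `(0, s_{d̂₁}]`, `G´ > 0` beyond, and the set of global minimizers is exactly `(0, s_{d̂₁}]` (0-based indexing of `ζ`). -/
theorem G_fullrank_cases
    (β : ℝ) (hβ : 0 < β) (d2 : ℕ) (hd2 : 1 ≤ d2)
    (d1h dsh : ℕ) (hd1h : 1 ≤ d1h) (hd1s : d1h ≤ dsh)
    (ζ : ℕ → ℝ) (hζpos : ∀ i < dsh, 0 < ζ i)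
    (hζmono : ∀ i j, i ≤ j → j < dsh → ζ j ≤ ζ i)
    (Ffun : ℕ → ℝ → ℝ)
    (hFfun : ∀ i (s : ℝ), Ffun i s = if s < ζ i ^ 2 / β
        then ζ i ^ 2 / s + β * (Real.log (β * s / ζ i ^ 2) - 1) else 0)
    (G : ℝ → ℝ)
    (hG : ∀ s : ℝ, G s = (1 / (2 * s)) * ∑ i ∈ Finset.range dsh, ζ i ^ 2
        - (1 / 2) * ∑ i ∈ Finset.range d1h, Ffun i s
        + ((d2 : ℝ) / 2) * Real.log s)
    (heq : d1h = dsh) :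
    ((β < (d2 : ℝ) / (d1h : ℝ)) →
      (∀ s : ℝ, 0 < s → 0 < deriv G s)
      ∧ StrictMonoOn G (Set.Ioi 0)
      ∧ (∀ s : ℝ, 0 < s → ¬ (∀ t : ℝ, 0 < t → G s ≤ G t)))
    ∧ ((β = (d2 : ℝ) / (d1h : ℝ)) →
      (∀ s : ℝ, 0 < s → s ≤ ζ (d1h - 1) ^ 2 / β → deriv G s = 0)
      ∧ (∀ s : ℝ, ζ (d1h - 1) ^ 2 / β < s → 0 < deriv G s)
      ∧ (∀ s : ℝ, (0 < s ∧ ∀ t : ℝ, 0 < t → G s ≤ G t)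
          ↔ (0 < s ∧ s ≤ ζ (d1h - 1) ^ 2 / β))) := by
  subst heq
  have hc : ∀ i ∈ Finset.range d1h, 0 < ζ i ^ 2 := fun i hi =>
    pow_pos (hζpos i (Finset.mem_range.1 hi)) 2
  have hD : ∀ s : ℝ, 0 < s → HasDerivAt G
      ((1 / 2) * (∑ i ∈ Finset.range d1h, -(min (β / s) (ζ i ^ 2 / s ^ 2)))
        + ((d2 : ℝ) / 2) * s⁻¹) s := by
    intro s hs
    have h1 := HasDerivAt.fun_sum (fun i hi => mode_hasDerivAt β (ζ i ^ 2) s hβ (hc i hi) hs)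
    have h2 := (h1.const_mul (1 / 2)).add ((Real.hasDerivAt_log hs.ne').const_mul ((d2 : ℝ) / 2))
    refine h2.congr_of_eventuallyEq (Filter.Eventually.of_forall ?_)
    intro x
    rw [hG]
    simp only [hFfun, Pi.add_apply]
    rw [Finset.sum_sub_distrib, ← Finset.sum_div]
    ring
  have hd1 : (0 : ℝ) < d1h := by exact_mod_cast hd1h
  have hcont : ContinuousOn G (Set.Ioi 0) := fun s hs =>
    (hD s hs).continuousAt.continuousWithinAt
  have hle : ∀ s : ℝ, 0 < s →
      ∑ i ∈ Finset.range d1h, min (β / s) (ζ i ^ 2 / s ^ 2) ≤ d1h * (β / s) := by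
    intro s hs
    calc _ ≤ ∑ i ∈ Finset.range d1h, β / s := Finset.sum_le_sum (fun i _ => min_le_left _ _)
      _ = _ := by simp
  have hderiv : ∀ s : ℝ, 0 < s → deriv G s =
      (1 / 2) * ((d2 : ℝ) / s - ∑ i ∈ Finset.range d1h, min (β / s) (ζ i ^ 2 / s ^ 2)) := by
    intro s hs
    rw [(hD s hs).deriv, Finset.sum_neg_distrib]
    ring
  constructor
  · intro hb
    rw [lt_div_iff₀ hd1] at hb
    have hpos : ∀ s : ℝ, 0 < s → 0 < deriv G s := by
      intro s hs
      rw [hderiv s hs]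
      have h1 := hle s hs
      have h2 : (d1h : ℝ) * (β / s) < d2 / s := by
        rw [← mul_div_assoc]
        apply div_lt_div_of_pos_right _ hs
        linarith
      linarith
    have hmono : StrictMonoOn G (Set.Ioi 0) :=
      strictMonoOn_of_deriv_pos (convex_Ioi 0) hcont (by
        intro s hs; rw [interior_Ioi] at hs; exact hpos s hs)
    refine ⟨hpos, hmono, fun s hs h => ?_⟩
    have h1 := h (s / 2) (by linarith)
    have h2 := hmono (Set.mem_Ioi.2 (half_pos hs)) (Set.mem_Ioi.2 hs) (half_lt_self hs)
    linarith
  · intro hb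
    have hb' : (d2 : ℝ) = d1h * β := by rw [hb]; field_simp
    have hlast : d1h - 1 ∈ Finset.range d1h := Finset.mem_range.2 (by omega)
    have hs0 : 0 < ζ (d1h - 1) ^ 2 / β := div_pos (hc _ hlast) hβ
    have hzero : ∀ s : ℝ, 0 < s → s ≤ ζ (d1h - 1) ^ 2 / β → deriv G s = 0 := by
      intro s hs hs'
      rw [hderiv s hs]
      have : ∑ i ∈ Finset.range d1h, min (β / s) (ζ i ^ 2 / s ^ 2)
          = ∑ i ∈ Finset.range d1h, β / s := by
        refine Finset.sum_congr rfl (fun i hi => min_eq_left ?_)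
        have hi' := Finset.mem_range.1 hi
        have h1 : ζ (d1h - 1) ≤ ζ i := hζmono i (d1h - 1) (by omega) (by omega)
        have h2 : ζ (d1h - 1) ^ 2 ≤ ζ i ^ 2 :=
          pow_le_pow_left₀ (hζpos _ (by omega)).le h1 2
        rw [le_div_iff₀ hβ] at hs'
        rw [div_le_div_iff₀ hs (by positivity)]
        nlinarith
      rw [this, hb']
      simp only [Finset.sum_const, Finset.card_range, nsmul_eq_mul]
      ring
    have hpos : ∀ s : ℝ, ζ (d1h - 1) ^ 2 / β < s → 0 < deriv G s := by
      intro s hs'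
      have hs : 0 < s := hs0.trans hs'
      rw [hderiv s hs]
      have : ∑ i ∈ Finset.range d1h, min (β / s) (ζ i ^ 2 / s ^ 2)
          < ∑ i ∈ Finset.range d1h, β / s := by
        refine Finset.sum_lt_sum (fun i _ => min_le_left _ _) ⟨d1h - 1, hlast, ?_⟩
        refine (min_le_right _ _).trans_lt ?_
        rw [div_lt_iff₀ hβ] at hs'
        rw [div_lt_div_iff₀ (by positivity) hs]
        nlinarith
      simp only [Finset.sum_const, Finset.card_range, nsmul_eq_mul] at this
      have h2 : (d2 : ℝ) / s = d1h * (β / s) := by rw [hb']; ring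
      linarith
    have hanti : AntitoneOn G (Set.Ioc 0 (ζ (d1h - 1) ^ 2 / β)) := by
      refine antitoneOn_of_deriv_nonpos (convex_Ioc _ _) (hcont.mono fun x hx => hx.1) ?_ ?_
      · intro x hx
        exact (hD x (interior_subset hx).1).differentiableAt.differentiableWithinAt
      · intro x hx
        exact (hzero x (interior_subset hx).1 (interior_subset hx).2).le
    have hmono : MonotoneOn G (Set.Ioi 0) := by
      refine monotoneOn_of_deriv_nonneg (convex_Ioi _) hcont ?_ ?_
      · intro x hx
        exact (hD x (interior_subset hx)).differentiableAt.differentiableWithinAt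
      · intro x hx
        rcases le_or_gt x (ζ (d1h - 1) ^ 2 / β) with h | h
        · exact (hzero x (interior_subset hx) h).ge
        · exact (hpos x h).le
    have hstrict : StrictMonoOn G (Set.Ici (ζ (d1h - 1) ^ 2 / β)) := by
      refine strictMonoOn_of_deriv_pos (convex_Ici _)
        (hcont.mono fun x hx => hs0.trans_le hx) ?_
      intro x hx
      rw [interior_Ici] at hx
      exact hpos x hx
    refine ⟨hzero, hpos, fun s => ⟨fun ⟨hs, h⟩ => ⟨hs, ?_⟩, fun ⟨hs, h⟩ => ⟨hs, fun t ht => ?_⟩⟩⟩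
    · by_contra hlt
      have hlt := not_le.1 hlt
      have h1 := hstrict (Set.mem_Ici.2 le_rfl) (Set.mem_Ici.2 hlt.le) hlt
      have h2 := h _ hs0
      linarith
    · rcases le_total s t with h' | h'
      · exact hmono hs ht h'
      · exact hanti ⟨ht, h'.trans h⟩ ⟨hs, h⟩ h'
end
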